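/- arXiv:0803.3541 — 5 statements merged into one kernel-verified Lean document; each statement's English description precedes it below -/
import Mathlib

section
/- Let X be a Banach space over ℝ whose dual X* is weak-star separable (there is a countable weak-star dense subset of X*) and which satisfies: for every set A ⊆ X* and every f in the weak-star closure of A, there is a countable subset A₀ ⊆ A such that f belongs to the weak-star closure of the linear span of A₀. Then X has the countable separation property (CSP). -/
open Set Cardinal Pointwise

/-- A Banach space `X` over `ℝ` has the countable separation property (CSP) if every set of
continuous linear functionals separating the points of `X` has a countable separating subset. -/
def HasCSP (X : Type*) [NormedAddCommGroup X] [NormedSpace ℝ X] : Prop :=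
  ∀ F : Set (X →L[ℝ] ℝ),
    (∀ x : X, x ≠ 0 → ∃ f ∈ F, f x ≠ 0) →
    ∃ F₀ : Set (X →L[ℝ] ℝ), F₀ ⊆ F ∧ F₀.Countable ∧
      ∀ x : X, x ≠ 0 → ∃ f ∈ F₀, f x ≠ 0

/-- A weak-star continuous linear functional on the dual is evaluation at a point. -/
theorem WeakDual.exists_forall_apply_eq {X : Type*} [NormedAddCommGroup X] [NormedSpace ℝ X]
    (φ : WeakDual ℝ X →L[ℝ] ℝ) : ∃ x : X, ∀ f : WeakDual ℝ X, φ f = f x := by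
  obtain ⟨x, hx⟩ := LinearMap.dualEmbedding_surjective (topDualPairing ℝ X) φ
  exact ⟨x, fun f => (DFunLike.congr_fun hx f).symm⟩

/-- The linear span of a separating set of functionals is weak-star dense. -/
theorem WeakDual.mem_closure_span_of_separating {X : Type*} [NormedAddCommGroup X]
    [NormedSpace ℝ X] {F : Set (WeakDual ℝ X)} (hF : ∀ x : X, x ≠ 0 → ∃ f ∈ F, f x ≠ 0)
    (g : WeakDual ℝ X) : g ∈ closure (Submodule.span ℝ F : Set (WeakDual ℝ X)) := by
  have : LocallyConvexSpace ℝ (WeakDual ℝ X) :=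
    inferInstanceAs (LocallyConvexSpace ℝ (WeakBilin (topDualPairing ℝ X)))
  by_contra hg
  obtain ⟨φ, u, hφu, hug⟩ := geometric_hahn_banach_closed_point
    (Submodule.span ℝ F).convex.closure isClosed_closure hg
  have hu : 0 < u := by
    simpa using hφu 0 (subset_closure (Submodule.zero_mem _))
  have hφ : ∀ f ∈ F, φ f = 0 := by
    intro f hf
    by_contra hne
    have := hφu ((u / φ f) • f)
      (subset_closure (Submodule.smul_mem _ _ (Submodule.subset_span hf)))
    rw [map_smul, smul_eq_mul, div_mul_cancel₀ _ hne] at this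
    exact lt_irrefl _ this
  obtain ⟨x, hx⟩ := exists_forall_apply_eq φ
  have hx0 : x = 0 := by
    by_contra hne
    obtain ⟨f, hf, hfx⟩ := hF x hne
    exact hfx (hx f ▸ hφ f hf)
  rw [hx g, hx0, map_zero] at hug
  exact hu.not_gt hug

/-- The functionals vanishing at a point form a weak-star closed set. -/
theorem WeakDual.isClosed_setOf_apply_eq_zero {X : Type*} [NormedAddCommGroup X]
    [NormedSpace ℝ X] (x : X) : IsClosed {f : WeakDual ℝ X | f x = 0} :=
  isClosed_eq (WeakDual.eval_continuous x) continuous_const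

/-- If all members of a set of functionals vanish at a point, so do all members of the
weak-star closed span. -/
theorem WeakDual.apply_eq_zero_of_mem_closure_span {X : Type*} [NormedAddCommGroup X]
    [NormedSpace ℝ X] {A : Set (WeakDual ℝ X)} {x : X} (hA : ∀ f ∈ A, f x = 0)
    {g : WeakDual ℝ X} (hg : g ∈ closure (Submodule.span ℝ A : Set (WeakDual ℝ X))) :
    g x = 0 := by
  refine closure_minimal (fun f hf => ?_) (isClosed_setOf_apply_eq_zero x) hg
  induction hf using Submodule.span_induction with
  | mem f hf => exact hA f hf
  | zero => rfl
  | add f₁ f₂ _ _ h₁ h₂ =>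
    change f₁ x + f₂ x = 0
    rw [show f₁ x = 0 from h₁, show f₂ x = 0 from h₂, add_zero]
  | smul c f _ h =>
    change c • f x = 0
    rw [show f x = 0 from h, smul_zero]

/-- A countable subset of a span is contained in the span of a countable subset. -/
theorem Set.Countable.exists_countable_subset_span {R M : Type*} [Semiring R] [AddCommMonoid M]
    [Module R M] {F A : Set M} (hA : A.Countable) (hAF : A ⊆ Submodule.span R F) :
    ∃ F₀ ⊆ F, F₀.Countable ∧ A ⊆ Submodule.span R F₀ := by
  choose! T hTF hT using fun a (ha : a ∈ A) =>
    Submodule.mem_span_finite_of_mem_span (hAF ha)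
  exact ⟨⋃ a ∈ A, T a, iUnion₂_subset hTF, hA.biUnion fun a _ => (T a).countable_toSet,
    fun a ha => Submodule.span_mono (subset_biUnion_of_mem (u := fun a => (T a : Set M)) ha)
      (hT a ha)⟩

/-- If the dual of a Banach space is weak-star separable and has the countable-span
tightness property (C'), then the space has CSP. -/
theorem hasCSP_of_weakStarSeparable_of_countableSpanTight (X : Type*)
    [NormedAddCommGroup X] [NormedSpace ℝ X] [CompleteSpace X]
    (hsep : ∃ D : Set (WeakDual ℝ X), D.Countable ∧ Dense D)
    (h4 : ∀ A : Set (WeakDual ℝ X), ∀ f ∈ closure A,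
      ∃ A₀ ⊆ A, A₀.Countable ∧
        f ∈ closure (Submodule.span ℝ A₀ : Set (WeakDual ℝ X))) :
    HasCSP X := by
  intro F hF
  obtain ⟨D, hDc, hD⟩ := hsep
  have hcount : ∀ d : WeakDual ℝ X, ∃ F₀ : Set (WeakDual ℝ X), F₀ ⊆ F ∧ F₀.Countable ∧
      d ∈ closure (Submodule.span ℝ F₀ : Set (WeakDual ℝ X)) := by
    intro d
    obtain ⟨A, hAF, hAc, hdA⟩ := h4 _ d (WeakDual.mem_closure_span_of_separating (F := F) hF d)
    obtain ⟨F₀, hF₀, hF₀c, hAF₀⟩ := hAc.exists_countable_subset_span hAF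
    exact ⟨F₀, hF₀, hF₀c, closure_mono (Submodule.span_le.2 hAF₀) hdA⟩
  choose G hGF hGc hG using hcount
  refine ⟨⋃ d ∈ D, G d, iUnion₂_subset fun d _ => hGF d, hDc.biUnion fun d _ => hGc d, ?_⟩
  intro x hx
  by_contra! h
  have hDx : ∀ d ∈ D, d x = 0 := fun d hd =>
    WeakDual.apply_eq_zero_of_mem_closure_span (fun f hf => h f (mem_biUnion hd hf)) (hG d)
  obtain ⟨f, -, hfx⟩ := hF x hx
  exact hfx (closure_minimal hDx (WeakDual.isClosed_setOf_apply_eq_zero x)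
    (hD (StrongDual.toWeakDual f)))
end

section
/- Let X be a Banach space over ℝ. Then the dual X* (with the dual norm) has the countable separation property (CSP) if and only if X is separable and X contains no isomorphic copy of ℓ¹, i.e., there is no continuous linear map T : ℓ¹ → X (where ℓ¹ is the Banach space of absolutely summable real sequences) for which there exists c > 0 with ‖T v‖ ≥ c‖v‖ for all v ∈ ℓ¹. -/
open Set Cardinal Pointwise

open Filter Topology

section FunctionalAnalysis

variable {Y : Type*} [NormedAddCommGroup Y] [NormedSpace ℝ Y]

theorem linear_eq_zero_of_bddAbove (f : Y →L[ℝ] ℝ) (p : Submodule ℝ Y) {u : ℝ}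
    (hf : ∀ a ∈ p, f a ≤ u) {a : Y} (ha : a ∈ p) : f a = 0 := by
  by_contra hne
  have := hf _ (p.smul_mem ((u + 1) / f a) ha)
  rw [map_smul, smul_eq_mul, div_mul_cancel₀ _ hne] at this
  linarith

theorem exists_functional_of_notMem_closure (p : Submodule ℝ Y) {x : Y}
    (hx : x ∉ closure (p : Set Y)) : ∃ f : Y →L[ℝ] ℝ, f x ≠ 0 ∧ ∀ a ∈ p, f a = 0 := by
  obtain ⟨f, u, hu, hux⟩ := geometric_hahn_banach_closed_point p.convex.closure isClosed_closure hx
  have h0 : ∀ a ∈ p, f a = 0 := fun a ha =>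
    linear_eq_zero_of_bddAbove f p (fun b hb => (hu b (subset_closure hb)).le) ha
  refine ⟨f, ?_, h0⟩
  have := hu 0 (subset_closure p.zero_mem)
  rw [map_zero] at this
  exact (this.trans hux).ne'

/-- Bounded nets of functionals have pointwise cluster points. -/
theorem exists_ultrafilter_limit {ι : Type*} (U : Ultrafilter ι) (ψ : ι → Y →L[ℝ] ℝ) {r : ℝ}
    (hψ : ∀ i, ‖ψ i‖ ≤ r) :
    ∃ φ : Y →L[ℝ] ℝ, ‖φ‖ ≤ r ∧ ∀ y, Tendsto (fun i => ψ i y) U (𝓝 (φ y)) := by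
  have hc := WeakDual.isCompact_closedBall (𝕜 := ℝ) (E := Y) 0 r
  let ψ' : ι → WeakDual ℝ Y := fun i => StrongDual.toWeakDual (ψ i)
  obtain ⟨φ, hφ, hle⟩ := hc.ultrafilter_le_nhds (U.map ψ') (by
    rw [le_principal_iff, Ultrafilter.coe_map, mem_map]
    refine Filter.mem_of_superset Filter.univ_mem fun i _ => ?_
    simpa [ψ'] using hψ i)
  refine ⟨WeakDual.toStrongDual φ, by simpa using hφ, fun y => ?_⟩
  have h1 : Tendsto ψ' U (𝓝 φ) := hle
  exact ((WeakDual.eval_continuous y).tendsto φ).comp h1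

theorem exists_limit_along_finset (r : ℝ) (ψ : Finset Y → Y →L[ℝ] ℝ) (hψ : ∀ i, ‖ψ i‖ ≤ r) :
    ∃ (U : Ultrafilter (Finset Y)) (φ : Y →L[ℝ] ℝ), (U : Filter (Finset Y)) ≤ atTop ∧ ‖φ‖ ≤ r ∧
      ∀ y, Tendsto (fun i => ψ i y) U (𝓝 (φ y)) := by
  obtain ⟨φ, h1, h2⟩ := exists_ultrafilter_limit (Ultrafilter.of atTop) ψ hψ
  exact ⟨_, φ, Ultrafilter.of_le _, h1, h2⟩

/-- Helly's theorem: elements of the bidual are approximated on finite sets by elements of the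
space with control of the norm. -/
theorem exists_approx_bidual (f : (Y →L[ℝ] ℝ) →L[ℝ] ℝ) (s : Finset (Y →L[ℝ] ℝ)) {η : ℝ}
    (hη : 0 < η) : ∃ z : Y, ‖z‖ ≤ ‖f‖ + 1 ∧ ∀ y ∈ s, |y z - f y| < η := by
  let T : Y →ₗ[ℝ] (s → ℝ) := LinearMap.pi fun y => (y : Y →L[ℝ] ℝ).toLinearMap
  let A : Set (s → ℝ) := T '' Metric.closedBall 0 (‖f‖ + 1)
  have hA : Convex ℝ A := (convex_closedBall _ _).linear_image T
  let q : s → ℝ := fun y => f y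
  have hq : q ∈ closure A := by
    by_contra hq
    obtain ⟨g, u, hu, huq⟩ := geometric_hahn_banach_closed_point hA.closure isClosed_closure hq
    classical
    let c : s → ℝ := fun i => g fun j => if i = j then 1 else 0
    have hg : ∀ w, g w = ∑ i, w i * c i := fun w =>
      LinearMap.pi_apply_eq_sum_univ (g : (s → ℝ) →ₗ[ℝ] ℝ) w
    let y : Y →L[ℝ] ℝ := ∑ i, c i • (i : Y →L[ℝ] ℝ)
    have hfy : g q = f y := by
      simp [hg, y, q, mul_comm]
    have hgz : ∀ z, g (T z) = y z := by
      intro z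
      simp [hg, y, T, mul_comm]
    have hb : ∀ z : Y, ‖z‖ ≤ ‖f‖ + 1 → y z ≤ u := fun z hz => by
      rw [← hgz]
      exact (hu _ (subset_closure ⟨z, by simpa using hz, rfl⟩)).le
    have hu0 : 0 ≤ u := by simpa using hb 0 (by simp; positivity)
    have hnorm : ‖y‖ * (‖f‖ + 1) ≤ u := by
      rw [← le_div_iff₀ (by positivity)]
      refine y.opNorm_le_of_unit_norm (by positivity) fun z hz => ?_
      have hn : ‖(‖f‖ + 1) • z‖ = ‖f‖ + 1 := by
        rw [norm_smul, hz, mul_one, Real.norm_of_nonneg (by positivity)]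
      have h1 := hb ((‖f‖ + 1) • z) hn.le
      have h2 := hb (-((‖f‖ + 1) • z)) (by rw [norm_neg, hn])
      rw [map_neg] at h2
      rw [map_smul, smul_eq_mul] at h1 h2
      rw [le_div_iff₀ (by positivity), Real.norm_eq_abs, ← abs_of_pos (by positivity : 0 < ‖f‖ + 1),
        ← abs_mul, abs_le]
      constructor <;> linarith
    have h1 := le_trans (le_abs_self _) (f.le_opNorm y)
    nlinarith [norm_nonneg y, norm_nonneg f]
  obtain ⟨_, ⟨z, hz, rfl⟩, hd⟩ := Metric.mem_closure_iff.1 hq η hη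
  refine ⟨z, by simpa using hz, fun y hy => ?_⟩
  rw [dist_comm] at hd
  exact (dist_pi_lt_iff hη).1 hd ⟨y, hy⟩

theorem exists_approx_bidual_dense (d : ℕ → Y) (hd : DenseRange d)
    (f : (Y →L[ℝ] ℝ) →L[ℝ] ℝ) (s : Finset (Y →L[ℝ] ℝ)) {η : ℝ} (hη : 0 < η) :
    ∃ n, ‖d n‖ < ‖f‖ + 2 ∧ ∀ y ∈ s, |y (d n) - f y| < η := by
  obtain ⟨z, hz⟩ := exists_approx_bidual f s hη
  have ho : IsOpen ({z : Y | ‖z‖ < ‖f‖ + 2} ∩ ⋂ y ∈ s, {z : Y | |y z - f y| < η}) := by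
    refine (isOpen_lt (by fun_prop) (by fun_prop)).inter (isOpen_biInter_finset fun y _ => ?_)
    exact isOpen_lt (by fun_prop) (by fun_prop)
  obtain ⟨_, h, n, rfl⟩ := hd.inter_open_nonempty _ ho
    ⟨z, lt_of_le_of_lt hz.1 (by linarith), by simpa using hz.2⟩
  exact ⟨n, by simpa using h⟩

/-- A functional on the dual which is weak-* continuous on bounded sets is an evaluation. -/
theorem exists_eq_eval [CompleteSpace Y] (Λ : (Y →L[ℝ] ℝ) →L[ℝ] ℝ)
    (h : ∀ ε > 0, ∃ G : Finset Y, ∀ ψ : Y →L[ℝ] ℝ, (∀ y ∈ G, ψ y = 0) → |Λ ψ| ≤ ε * ‖ψ‖) :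
    ∃ y : Y, ∀ ψ, Λ ψ = ψ y := by
  let J := NormedSpace.inclusionInDoubleDualLi ℝ (E := Y)
  have hcl : IsClosed (range J) := J.isometry.isUniformInducing.isComplete_range.isClosed
  suffices hΛ : Λ ∈ closure (range J) by
    rw [hcl.closure_eq] at hΛ
    obtain ⟨y, rfl⟩ := hΛ
    exact ⟨y, fun ψ => rfl⟩
  refine (Metric.mem_closure_iff (α := (Y →L[ℝ] ℝ) →L[ℝ] ℝ)).2 fun ε hε => ?_
  obtain ⟨G, hG⟩ := h (ε / 2) (by positivity)
  let p : Submodule ℝ (Y →L[ℝ] ℝ) := ⨅ y : G, (J y).toLinearMap.ker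
  have hp : ∀ ψ, ψ ∈ p ↔ ∀ y ∈ G, ψ y = 0 := by
    intro ψ
    simp only [p, Submodule.mem_iInf, LinearMap.mem_ker, Subtype.forall]
    rfl
  obtain ⟨Λ₂, h2, h2n⟩ := _root_.exists_extension_norm_eq p (Λ.comp p.subtypeL)
  have hn : ‖Λ₂‖ ≤ ε / 2 := by
    rw [h2n]
    refine ContinuousLinearMap.opNorm_le_bound _ (by positivity) fun ψ => ?_
    exact hG ψ ((hp _).1 ψ.2)
  have hs : ((Λ - Λ₂ : (Y →L[ℝ] ℝ) →L[ℝ] ℝ) : (Y →L[ℝ] ℝ) →ₗ[ℝ] ℝ) ∈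
      Submodule.span ℝ (range fun y : G => (J y).toLinearMap) := by
    apply mem_span_of_iInf_ker_le_ker
    intro ψ hψ
    have := h2 ⟨ψ, hψ⟩
    simp at this
    simp [this]
  obtain ⟨y, hy⟩ : ∃ y : Y, ∀ ψ, (Λ - Λ₂) ψ = ψ y := by
    suffices H : ∀ K ∈ Submodule.span ℝ (range fun y : G => (J y).toLinearMap),
        ∃ y : Y, ∀ ψ : Y →L[ℝ] ℝ, K ψ = ψ y from H _ hs
    intro K hK
    induction hK using Submodule.span_induction with
    | mem K hK => obtain ⟨y, rfl⟩ := hK; exact ⟨y, fun ψ => rfl⟩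
    | zero => exact ⟨0, fun ψ => by simp⟩
    | add K L _ _ hK hL =>
      obtain ⟨y, hy⟩ := hK
      obtain ⟨z, hz⟩ := hL
      exact ⟨y + z, fun ψ => by simp [hy, hz]⟩
    | smul c K _ hK =>
      obtain ⟨y, hy⟩ := hK
      exact ⟨c • y, fun ψ => by simp [hy]⟩
  refine ⟨J y, ⟨y, rfl⟩, ?_⟩
  have : Λ - J y = Λ₂ := by
    ext ψ
    have := hy ψ
    simp only [sub_apply] at this ⊢
    change Λ ψ - ψ y = _
    linarith
  calc dist Λ (J y) = ‖Λ - J y‖ := dist_eq_norm (E := (Y →L[ℝ] ℝ) →L[ℝ] ℝ) _ _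
    _ < ε := by rw [this]; linarith

/-- One step of the Banach–Dieudonné construction. -/
theorem exists_finset_separating_step (E : Submodule ℝ (Y →L[ℝ] ℝ))
    (hE : ∀ (r : ℝ) (φ : Y →L[ℝ] ℝ), (∀ (s : Finset Y), ∀ ε > 0, ∃ ψ ∈ E, ‖ψ‖ ≤ r ∧
      ∀ y ∈ s, |ψ y - φ y| < ε) → φ ∈ E) (φ : Y →L[ℝ] ℝ) {R R' : ℝ} (hR : 0 < R) (F : Finset Y)
    (hF : ∀ ψ ∈ E, ‖ψ - φ‖ ≤ R → ∃ y ∈ F, 1 < |(ψ - φ) y|) :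
    ∃ F' : Finset Y, F ⊆ F' ∧ (∀ y ∈ F', y ∉ F → ‖y‖ ≤ 1 / R) ∧
      ∀ ψ ∈ E, ‖ψ - φ‖ ≤ R' → ∃ y ∈ F', 1 < |(ψ - φ) y| := by
  classical
  by_contra! hcon
  have hall : ∀ s : Finset Y, ∃ ψ ∈ E, ‖ψ - φ‖ ≤ R' ∧
      ∀ y ∈ F ∪ s.filter (fun y => ‖y‖ ≤ 1 / R), |(ψ - φ) y| ≤ 1 := fun s =>
    hcon _ Finset.subset_union_left fun y hy hyF => by
      rcases Finset.mem_union.1 hy with h | h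
      · exact absurd h hyF
      · exact (Finset.mem_filter.1 h).2
  choose ψ hψE hψn hψ using hall
  obtain ⟨U, χ, hU, hχn, hχ⟩ := exists_limit_along_finset R' (fun s => ψ s - φ) hψn
  have hmem : χ + φ ∈ E := by
    refine hE (R' + ‖φ‖) _ fun s ε hε => ?_
    have : ∀ᶠ i in (U : Filter (Finset Y)), ∀ y ∈ s, |(ψ i - φ) y - χ y| < ε := by
      rw [Filter.eventually_all_finset]
      intro y _
      exact (Metric.tendsto_nhds.1 (hχ y)) ε hε
    obtain ⟨i, hi⟩ := this.exists
    refine ⟨ψ i, hψE i, ?_, fun y hy => ?_⟩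
    · calc ‖ψ i‖ = ‖(ψ i - φ) + φ‖ := by rw [sub_add_cancel]
        _ ≤ _ := (norm_add_le _ _).trans (by linarith [hψn i])
    · have := hi y hy
      simp only [sub_apply, add_apply] at this ⊢
      rwa [sub_add_eq_sub_sub_swap]
  have hb : ∀ y : Y, (y ∈ F ∨ ‖y‖ ≤ 1 / R) → |χ y| ≤ 1 := by
    intro y hy
    refine le_of_tendsto (hχ y).abs ?_
    filter_upwards [hU (Filter.eventually_ge_atTop {y})] with s hs
    refine hψ s y ?_
    have : y ∈ s := hs (by simp)
    simp only [Finset.mem_union, Finset.mem_filter]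
    tauto
  obtain ⟨y, hyF, hy⟩ := hF _ hmem (by
    rw [add_sub_cancel_right]
    refine χ.opNorm_le_of_unit_norm hR.le fun z hz => ?_
    have h1 := hb (R⁻¹ • z) (Or.inr (by
      rw [norm_smul, hz, mul_one, one_div, Real.norm_of_nonneg (by positivity)]))
    rwa [map_smul, smul_eq_mul, abs_mul, abs_of_pos (by positivity), inv_mul_le_iff₀ hR,
      mul_one] at h1)
  rw [add_sub_cancel_right] at hy
  exact absurd (hb y (Or.inl hyF)) hy.not_ge

theorem exists_finset_sequence (E : Submodule ℝ (Y →L[ℝ] ℝ))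
    (hE : ∀ (r : ℝ) (φ : Y →L[ℝ] ℝ), (∀ (s : Finset Y), ∀ ε > 0, ∃ ψ ∈ E, ‖ψ‖ ≤ r ∧
      ∀ y ∈ s, |ψ y - φ y| < ε) → φ ∈ E) (φ : Y →L[ℝ] ℝ)
    (hφ : ∀ ψ ∈ E, 1 < ‖ψ - φ‖) :
    ∃ F : ℕ → Finset Y, F 0 = ∅ ∧ ∀ n, F n ⊆ F (n + 1) ∧
      (∀ y ∈ F (n + 1), y ∉ F n → ‖y‖ ≤ 1 / (n + 1 : ℝ)) ∧
      ∀ ψ ∈ E, ‖ψ - φ‖ ≤ (n + 1 : ℝ) → ∃ y ∈ F n, 1 < |(ψ - φ) y| := by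
  let P : ℕ → Finset Y → Prop := fun n F =>
    ∀ ψ ∈ E, ‖ψ - φ‖ ≤ (n + 1 : ℝ) → ∃ y ∈ F, 1 < |(ψ - φ) y|
  have hstep : ∀ n (F : Finset Y), P n F → ∃ F' : Finset Y, F ⊆ F' ∧
      (∀ y ∈ F', y ∉ F → ‖y‖ ≤ 1 / (n + 1 : ℝ)) ∧ P (n + 1) F' := fun n F hF =>
    exists_finset_separating_step E hE φ (by positivity) F hF
  choose! next h1 h2 h3 using hstep
  let F : ℕ → Finset Y := fun n => Nat.rec ∅ next n
  have hP : ∀ n, P n (F n) := by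
    intro n
    induction n with
    | zero =>
      intro ψ hψ hn
      have := hφ ψ hψ
      simp only [Nat.cast_zero, zero_add] at hn
      linarith
    | succ n ih => exact h3 n _ ih
  exact ⟨F, rfl, fun n => ⟨h1 n _ (hP n), h2 n _ (hP n), hP n⟩⟩

/-- The Krein–Smulian (Banach–Dieudonné) theorem for total subspaces: a total subspace of the dual
whose bounded parts are weak-* closed is everything. -/
theorem eq_top_of_total_of_bounded_closed [CompleteSpace Y] (E : Submodule ℝ (Y →L[ℝ] ℝ))
    (hE : ∀ (r : ℝ) (φ : Y →L[ℝ] ℝ), (∀ (s : Finset Y), ∀ ε > 0, ∃ ψ ∈ E, ‖ψ‖ ≤ r ∧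
      ∀ y ∈ s, |ψ y - φ y| < ε) → φ ∈ E)
    (htot : ∀ y, (∀ ψ ∈ E, ψ y = 0) → y = 0) (φ : Y →L[ℝ] ℝ) : φ ∈ E := by
  by_contra hφ
  have hcl : IsClosed (E : Set (Y →L[ℝ] ℝ)) := by
    refine isClosed_of_closure_subset fun χ hχ => hE (‖χ‖ + 1) χ fun s ε hε => ?_
    have hM : 0 < 1 + ∑ y ∈ s, ‖y‖ := by positivity
    obtain ⟨ψ, hψ, hd⟩ := Metric.mem_closure_iff.1 hχ (min 1 (ε / (1 + ∑ y ∈ s, ‖y‖)))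
      (by positivity)
    rw [dist_comm, dist_eq_norm, lt_min_iff] at hd
    refine ⟨ψ, hψ, ?_, fun y hy => ?_⟩
    · have := norm_sub_norm_le ψ χ
      linarith
    · have h1 : ‖y‖ ≤ ∑ y ∈ s, ‖y‖ := Finset.single_le_sum (fun y _ => norm_nonneg y) hy
      have h2 := (ψ - χ).le_opNorm y
      rw [Real.norm_eq_abs] at h2
      have h3 := (lt_div_iff₀ hM).1 hd.2
      calc |ψ y - χ y| ≤ ‖ψ - χ‖ * ‖y‖ := h2
        _ ≤ ‖ψ - χ‖ * (1 + ∑ y ∈ s, ‖y‖) := by gcongr; linarith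
        _ < ε := h3
  obtain ⟨ρ, hρ, hρd⟩ : ∃ ρ > 0, ∀ ψ ∈ E, ρ ≤ ‖ψ - φ‖ := by
    obtain ⟨ρ, hρ, h⟩ := Metric.isOpen_iff.1 hcl.isOpen_compl φ hφ
    refine ⟨ρ, hρ, fun ψ hψ => not_lt.1 fun hlt => h (?_ : ψ ∈ _) hψ⟩
    rwa [Metric.mem_ball, dist_eq_norm]
  obtain ⟨φ', hφ'⟩ : ∃ φ' : Y →L[ℝ] ℝ, ∀ ψ ∈ E, 1 < ‖ψ - φ'‖ := by
    refine ⟨(2 / ρ) • φ, fun ψ hψ => ?_⟩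
    have h1 := hρd _ (E.smul_mem (ρ / 2) hψ)
    have h2 : ψ - (2 / ρ) • φ = (2 / ρ) • ((ρ / 2) • ψ - φ) := by
      rw [smul_sub, smul_smul]
      field_simp
      simp
    rw [h2, norm_smul, Real.norm_of_nonneg (by positivity)]
    calc (1 : ℝ) < 2 / ρ * ρ := by field_simp; norm_num
      _ ≤ _ := by gcongr
  obtain ⟨F, hF0, hF⟩ := exists_finset_sequence E hE φ' hφ'
  have hmono : Monotone F := monotone_nat_of_le_succ fun n => (hF n).1
  have hsmall : ∀ n m, ∀ y ∈ F m, y ∉ F n → ‖y‖ ≤ 1 / (n + 1 : ℝ) := by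
    intro n m
    induction m with
    | zero => simp [hF0]
    | succ m ih =>
      intro y hy hyn
      by_cases hym : y ∈ F m
      · exact ih y hym hyn
      · refine ((hF m).2.1 y hy hym).trans ?_
        have : n ≤ m := by
          by_contra! hlt
          exact hyn (hmono hlt hy)
        gcongr
  have hle1 : ∀ m, ∀ y ∈ F m, ‖y‖ ≤ 1 := fun m y hy => by
    simpa using hsmall 0 m y hy (by simp [hF0])
  let V : Set (Y →L[ℝ] ℝ) := {ψ | ∃ t < 1, ∀ n, ∀ y ∈ F n, |ψ y| ≤ t}
  have hVc : Convex ℝ V := by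
    rintro ψ ⟨t, ht, hψ⟩ χ ⟨t', ht', hχ⟩ a b ha hb hab
    refine ⟨max t t', max_lt ht ht', fun n y hy => ?_⟩
    have h1 := (hψ n y hy).trans (le_max_left t t')
    have h2 := (hχ n y hy).trans (le_max_right t t')
    have h3 : |a * ψ y + b * χ y| ≤ |a * ψ y| + |b * χ y| := abs_add_le _ _
    rw [abs_mul, abs_mul, abs_of_nonneg ha, abs_of_nonneg hb] at h3
    change |a * ψ y + b * χ y| ≤ _
    obtain rfl : b = 1 - a := by linarith
    nlinarith
  have hVo : IsOpen V := by
    rw [Metric.isOpen_iff]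
    rintro ψ ⟨t, ht, hψ⟩
    refine ⟨(1 - t) / 2, by linarith, fun χ hχ => ⟨t + (1 - t) / 2, by linarith, fun n y hy => ?_⟩⟩
    rw [Metric.mem_ball, dist_eq_norm] at hχ
    have h1 := (χ - ψ).le_opNorm y
    have h2 := hle1 n y hy
    have h3 : |χ y| ≤ |ψ y| + |χ y - ψ y| := by
      have := abs_add_le (ψ y) (χ y - ψ y)
      simpa using this
    have h4 : |χ y - ψ y| ≤ ‖χ - ψ‖ * ‖y‖ := h1
    have := hψ n y hy
    nlinarith [norm_nonneg (χ - ψ), norm_nonneg y]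
  have hdisj : Disjoint (φ' +ᵥ V) (E : Set (Y →L[ℝ] ℝ)) := by
    rw [Set.disjoint_left]
    rintro _ ⟨χ, ⟨t, ht, hχ⟩, rfl⟩ hmem
    obtain ⟨n, hn⟩ := exists_nat_ge ‖χ‖
    obtain ⟨y, hy, hlt⟩ := (hF n).2.2 _ hmem (by
      simp only [vadd_eq_add, add_sub_cancel_left]; linarith)
    simp only [vadd_eq_add, add_sub_cancel_left] at hlt
    linarith [hχ n y hy]
  obtain ⟨Λ, u, hΛV, hΛE⟩ := geometric_hahn_banach_open (hVc.vadd φ') (hVo.vadd φ') E.convex hdisj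
  have hu : u ≤ 0 := by simpa using hΛE 0 E.zero_mem
  have hΛ0 : ∀ ψ ∈ E, Λ ψ = 0 := fun ψ hψ => by
    have := linear_eq_zero_of_bddAbove (-Λ) E (u := -u) (fun a ha => by
      simpa using hΛE a ha) hψ
    simpa using this
  have hV0 : ∀ χ ∈ V, Λ φ' + Λ χ < 0 := fun χ hχ => by
    have := hΛV (φ' + χ) ⟨χ, hχ, rfl⟩
    rw [map_add] at this
    linarith
  have hΛφ : Λ φ' < 0 := by
    simpa using hV0 0 ⟨0, by norm_num, by simp⟩
  obtain ⟨y, hy⟩ := exists_eq_eval Λ (by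
    intro ε hε
    obtain ⟨n, hn⟩ := exists_nat_one_div_lt (show 0 < ε / (2 * (-Λ φ')) by
      have : 0 < -Λ φ' := by linarith
      positivity)
    refine ⟨F n, fun ψ hψ => ?_⟩
    have key : ∀ χ : Y →L[ℝ] ℝ, (∀ y ∈ F n, χ y = 0) → Λ χ ≤ ε * ‖χ‖ := by
      intro χ hχ
      rcases eq_or_ne χ 0 with rfl | hne
      · simp
      have hpos : 0 < ‖χ‖ := norm_pos_iff.2 hne
      set c : ℝ := (n + 1) / (2 * ‖χ‖) with hc
      have hcpos : 0 < c := by positivity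
      have := hV0 (c • χ) ⟨1 / 2, by norm_num, fun m y hy => by
        by_cases hyn : y ∈ F n
        · simp [hχ y hyn]
        have h1 := hsmall n m y hy hyn
        have h2 := χ.le_opNorm y
        rw [Real.norm_eq_abs] at h2
        change |c * χ y| ≤ _
        rw [abs_mul, abs_of_pos hcpos]
        calc c * |χ y| ≤ c * (‖χ‖ * (1 / (n + 1 : ℝ))) := by
              gcongr
              exact h2.trans (by gcongr)
          _ = 1 / 2 := by rw [hc]; field_simp⟩
      rw [map_smul, smul_eq_mul] at this
      have h3 : Λ χ ≤ -Λ φ' / c := by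
        rw [le_div_iff₀ hcpos]
        linarith
      refine h3.trans ?_
      have h4 : 0 < -Λ φ' := by linarith
      rw [lt_div_iff₀ (by positivity)] at hn
      calc -Λ φ' / c = (1 / (n + 1 : ℝ) * (2 * -Λ φ')) * ‖χ‖ := by rw [hc]; field_simp
        _ ≤ ε * ‖χ‖ := by gcongr
    rw [abs_le]
    have h1 := key ψ hψ
    have h2 := key (-ψ) fun y hy => by simp [hψ y hy]
    rw [map_neg, norm_neg] at h2
    constructor <;> linarith)
  have hy0 : y = 0 := htot y fun ψ hψ => by rw [← hy, hΛ0 ψ hψ]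
  rw [hy, hy0, map_zero] at hΛφ
  exact lt_irrefl _ hΛφ

end FunctionalAnalysis

section Fragmentation

/-- A function bounded above on `S` almost attains a fixed upper bound on each nonempty relatively
open subset of a suitable relatively open set. -/
theorem exists_open_uniform_sup {α β : Type*} [TopologicalSpace α] (e : β → α) (S : Set β)
    (hS : S.Nonempty) (f : β → ℝ) (B : ℝ) (hB : ∀ s ∈ S, |f s| ≤ B) {δ : ℝ} (hδ : 0 < δ) :
    ∃ (W : Set α) (v : ℝ), IsOpen W ∧ (S ∩ e ⁻¹' W).Nonempty ∧ (∀ s ∈ S ∩ e ⁻¹' W, f s ≤ v) ∧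
      ∀ U, IsOpen U → (S ∩ e ⁻¹' W ∩ e ⁻¹' U).Nonempty →
        ∃ s ∈ S ∩ e ⁻¹' W ∩ e ⁻¹' U, v - δ < f s := by
  let V : Set ℝ := {v | ∃ W : Set α, IsOpen W ∧ (S ∩ e ⁻¹' W).Nonempty ∧
    ∀ s ∈ S ∩ e ⁻¹' W, f s ≤ v}
  have hne : V.Nonempty :=
    ⟨B, univ, isOpen_univ, by simpa using hS, fun s hs => (abs_le.1 (hB s hs.1)).2⟩
  have hbd : BddBelow V := by
    refine ⟨-B, ?_⟩
    rintro v ⟨W, -, ⟨s, hs⟩, hv⟩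
    exact (abs_le.1 (hB s hs.1)).1.trans (hv s hs)
  obtain ⟨v, ⟨W, hW, hWne, hv⟩, hlt⟩ := exists_lt_of_csInf_lt hne
    (show sInf V < sInf V + δ by linarith)
  refine ⟨W, v, hW, hWne, hv, fun U hU hne' => ?_⟩
  by_contra! hcon
  have : v - δ ∈ V := by
    refine ⟨W ∩ U, hW.inter hU, ?_, ?_⟩
    · rwa [preimage_inter, ← inter_assoc]
    · rwa [preimage_inter, ← inter_assoc]
  linarith [csInf_le hbd this]

theorem exists_gap_of_not_fragmented {α β : Type*} [TopologicalSpace α] (e : β → α) (S : Set β)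
    (hS : S.Nonempty) (f : β → ℝ) (B : ℝ) (hB : ∀ s ∈ S, |f s| ≤ B) {ε : ℝ} (hε : 0 < ε)
    (hosc : ∀ U, IsOpen U → (S ∩ e ⁻¹' U).Nonempty →
      ∃ s ∈ S ∩ e ⁻¹' U, ∃ t ∈ S ∩ e ⁻¹' U, ε ≤ f s - f t) :
    ∃ (S' : Set β) (a b : ℝ), S' ⊆ S ∧ S'.Nonempty ∧ a < b ∧
      ∀ U, IsOpen U → (S' ∩ e ⁻¹' U).Nonempty →
        (∃ s ∈ S' ∩ e ⁻¹' U, b < f s) ∧ ∃ s ∈ S' ∩ e ⁻¹' U, f s < a := by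
  obtain ⟨W, v, hW, hWne, hv, h1⟩ := exists_open_uniform_sup e S hS f B hB
    (show 0 < ε / 3 by positivity)
  obtain ⟨W', w, hW', hWne', hw, h2⟩ := exists_open_uniform_sup e (S ∩ e ⁻¹' W) hWne
    (fun s => -f s) B (fun s hs => by rw [abs_neg]; exact hB s hs.1) (show 0 < ε / 3 by positivity)
  have hsub : ∀ s ∈ S ∩ e ⁻¹' (W ∩ W'), s ∈ S ∩ e ⁻¹' W ∩ e ⁻¹' W' := fun s hs =>
    ⟨⟨hs.1, hs.2.1⟩, hs.2.2⟩
  refine ⟨S ∩ e ⁻¹' W ∩ e ⁻¹' W', -w + ε / 3, v - ε / 3, fun s hs => hs.1.1, hWne', ?_, ?_⟩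
  · obtain ⟨s, hs, t, ht, hst⟩ := hosc (W ∩ W') (hW.inter hW') (by
      obtain ⟨s, hs⟩ := hWne'
      exact ⟨s, hs.1.1, hs.1.2, hs.2⟩)
    have := hv s (hsub s hs).1
    have := hw t (hsub t ht)
    linarith
  · intro U hU hne
    constructor
    · obtain ⟨s, hs, h⟩ := h1 (W' ∩ U) (hW'.inter hU) (by
        obtain ⟨s, hs⟩ := hne
        exact ⟨s, hs.1.1, hs.1.2, hs.2⟩)
      exact ⟨s, ⟨⟨hs.1, hs.2.1⟩, hs.2.2⟩, h⟩
    · obtain ⟨s, hs, h⟩ := h2 U hU hne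
      exact ⟨s, hs, by linarith⟩

/-- Diagonal construction of a sequence from one-step extensions of finite initial segments. -/
theorem exists_seq_of_forall_extend {α : Type*} [Inhabited α] (P : ∀ n : ℕ, (Fin n → α) → Prop)
    (h0 : ∀ k, P 0 k) (hstep : ∀ n k, P n k → ∃ m, P (n + 1) (Fin.snoc k m)) :
    ∃ k : ℕ → α, ∀ n, P n fun i => k i := by
  choose! next hnext using hstep
  let K : ∀ n, Fin n → α := fun n => Nat.rec (fun i => i.elim0) (fun n k => Fin.snoc k (next n k)) n
  have hK : ∀ n, K (n + 1) = Fin.snoc (K n) (next n (K n)) := fun n => rfl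
  have hP : ∀ n, P n (K n) := by
    intro n
    induction n with
    | zero => exact h0 _
    | succ n ih => rw [hK]; exact hnext n _ ih
  refine ⟨fun n => next n (K n), fun n => ?_⟩
  have : (fun i : Fin n => next i (K i)) = K n := by
    induction n with
    | zero => ext i; exact i.elim0
    | succ n ih =>
      rw [hK]
      ext i
      refine Fin.lastCases ?_ (fun i => ?_) i
      · simp
      · rw [Fin.snoc_castSucc, ← ih]
        simp
  rw [this]
  exact hP n

variable {X : Type*} [NormedAddCommGroup X] [NormedSpace ℝ X]

theorem exists_independent_of_gap (d : ℕ → X) (hd : DenseRange d) (S : Set (X →L[ℝ] ℝ))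
    (hS : S.Nonempty) (f : (X →L[ℝ] ℝ) →L[ℝ] ℝ) {a b η : ℝ} (hη : 0 < η)
    (hgap : ∀ U : Set (ℕ → ℝ), IsOpen U → (S ∩ (fun y n => y (d n)) ⁻¹' U).Nonempty →
        (∃ s ∈ S ∩ (fun y n => y (d n)) ⁻¹' U, b < f s) ∧
          ∃ s ∈ S ∩ (fun y n => y (d n)) ⁻¹' U, f s < a) :
    ∃ x : ℕ → X, (∀ n, ‖x n‖ ≤ ‖f‖ + 2) ∧ ∀ n, ∀ σ : ℕ → Bool, ∃ s ∈ S, ∀ i < n,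
      if σ i then b - η < s (x i) else s (x i) < a + η := by
  let P : ∀ n : ℕ, (Fin n → ℕ) → Prop := fun n k => (∀ i, ‖d (k i)‖ ≤ ‖f‖ + 2) ∧
    ∀ σ : Fin n → Bool, ∃ s ∈ S, ∀ i, if σ i then b - η < s (d (k i)) else s (d (k i)) < a + η
  have hstep : ∀ n k, P n k → ∃ m, P (n + 1) (Fin.snoc k m) := by
    rintro n k ⟨hk, hσ⟩
    have hpts : ∀ σ : Fin n → Bool, ∀ τ : Bool, ∃ s ∈ S,
        (∀ i, if σ i then b - η < s (d (k i)) else s (d (k i)) < a + η) ∧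
        if τ then b < f s else f s < a := by
      intro σ τ
      let U : Set (ℕ → ℝ) :=
        ⋂ i, {w | if σ i then b - η < w (k i) else w (k i) < a + η}
      have hU : IsOpen U := by
        refine isOpen_iInter_of_finite fun i => ?_
        cases σ i
        · simpa using isOpen_lt (continuous_apply (k i)) continuous_const
        · simpa using isOpen_lt continuous_const (continuous_apply (k i))
      obtain ⟨s, hs, hsU⟩ := hσ σ
      obtain ⟨⟨p, hp, hpf⟩, q, hq, hqf⟩ := hgap U hU ⟨s, hs, mem_iInter.2 hsU⟩
      cases τ
      · exact ⟨q, hq.1, mem_iInter.1 hq.2, by simpa using hqf⟩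
      · exact ⟨p, hp.1, mem_iInter.1 hp.2, by simpa using hpf⟩
    choose p hpS hpk hpf using hpts
    classical
    obtain ⟨m, hm, hmp⟩ := exists_approx_bidual_dense d hd f
      (Finset.univ.image fun στ : (Fin n → Bool) × Bool => p στ.1 στ.2) hη
    have hmp' : ∀ σ τ, |p σ τ (d m) - f (p σ τ)| < η := fun σ τ =>
      hmp _ (Finset.mem_image.2 ⟨(σ, τ), Finset.mem_univ _, rfl⟩)
    refine ⟨m, fun i => ?_, fun σ => ?_⟩
    · refine Fin.lastCases ?_ (fun i => ?_) i
      · simpa using hm.le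
      · simpa using hk i
    · refine ⟨p (fun i => σ i.castSucc) (σ (Fin.last n)), hpS _ _, fun i => ?_⟩
      refine Fin.lastCases ?_ (fun i => ?_) i
      · have h1 := abs_lt.1 (hmp' (fun i => σ i.castSucc) (σ (Fin.last n)))
        have h2 := hpf (fun i => σ i.castSucc) (σ (Fin.last n))
        rw [Fin.snoc_last]
        generalize p (fun i => σ i.castSucc) (σ (Fin.last n)) = y at h1 h2 ⊢
        generalize σ (Fin.last n) = τ at h2 ⊢
        cases τ
        · simp only [Bool.false_eq_true, if_false] at h2 ⊢
          linarith
        · simp only [if_true] at h2 ⊢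
          linarith
      · rw [Fin.snoc_castSucc]
        exact hpk (fun i => σ i.castSucc) (σ (Fin.last n)) i
  obtain ⟨k, hk⟩ := exists_seq_of_forall_extend P
    (fun k => ⟨fun i => i.elim0, fun _ => hS.imp fun s hs => ⟨hs, fun i => i.elim0⟩⟩) hstep
  refine ⟨fun n => d (k n), fun n => (hk (n + 1)).1 (Fin.last n), fun n σ => ?_⟩
  obtain ⟨s, hs, h⟩ := (hk n).2 fun i => σ i
  exact ⟨s, hs, fun i hi => h ⟨i, hi⟩⟩

/-- A bounded sequence which is independent on a bounded set of functionals spans `ℓ¹`. -/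
theorem exists_l1_embedding_of_independent [CompleteSpace X] (x : ℕ → X) {M : ℝ}
    (hM : ∀ n, ‖x n‖ ≤ M) (S : Set (X →L[ℝ] ℝ)) {R : ℝ} (hR : ∀ s ∈ S, ‖s‖ ≤ R) {a b : ℝ}
    (hab : a < b) (hind : ∀ n, ∀ σ : ℕ → Bool, ∃ s ∈ S, ∀ i < n,
      if σ i then b < s (x i) else s (x i) < a) :
    ∃ (T : lp (fun _ : ℕ => ℝ) 1 →L[ℝ] X) (c : ℝ), 0 < c ∧
      ∀ v : lp (fun _ : ℕ => ℝ) 1, c * ‖v‖ ≤ ‖T v‖ := by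
  have hM0 : 0 ≤ M := (norm_nonneg _).trans (hM 0)
  have hnorm : ∀ v : lp (fun _ : ℕ => ℝ) 1, HasSum (fun i => |v i|) ‖v‖ := fun v => by
    simpa using lp.hasSum_norm (p := 1) (by norm_num) v
  have hbound : ∀ (v : lp (fun _ : ℕ => ℝ) 1) i, ‖v i • x i‖ ≤ M * |v i| := fun v i => by
    rw [norm_smul, Real.norm_eq_abs, mul_comm]
    gcongr
    exact hM i
  have hsum : ∀ v : lp (fun _ : ℕ => ℝ) 1, Summable fun i => v i • x i := fun v =>
    Summable.of_norm_bounded ((hnorm v).summable.mul_left M) (hbound v)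
  let T₀ : lp (fun _ : ℕ => ℝ) 1 →ₗ[ℝ] X :=
    { toFun := fun v => ∑' i, v i • x i
      map_add' := fun v w => by
        rw [← (hsum v).tsum_add (hsum w)]
        simp [add_smul]
      map_smul' := fun c v => by
        rw [RingHom.id_apply, ← (hsum v).tsum_const_smul]
        simp [mul_smul] }
  let T := T₀.mkContinuous M fun v =>
    tsum_of_norm_bounded ((hnorm v).mul_left M) (hbound v)
  have hR0 : 0 ≤ R := by
    obtain ⟨s, hs, -⟩ := hind 0 fun _ => true
    exact (norm_nonneg _).trans (hR s hs)
  refine ⟨T, (b - a) / (2 * R + 1), div_pos (by linarith) (by linarith), fun v => ?_⟩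
  have hpart : ∀ n, (b - a) * ∑ i ∈ Finset.range n, |v i| ≤
      (2 * R) * ‖∑ i ∈ Finset.range n, v i • x i‖ := by
    intro n
    obtain ⟨s, hs, h1⟩ := hind n fun i => decide (0 ≤ v i)
    obtain ⟨t, ht, h2⟩ := hind n fun i => !decide (0 ≤ v i)
    have hst : ‖s - t‖ ≤ 2 * R := (norm_sub_le _ _).trans (by linarith [hR s hs, hR t ht])
    calc (b - a) * ∑ i ∈ Finset.range n, |v i| = ∑ i ∈ Finset.range n, (b - a) * |v i| := by
          rw [Finset.mul_sum]
      _ ≤ ∑ i ∈ Finset.range n, v i * (s - t) (x i) := by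
          refine Finset.sum_le_sum fun i hi => ?_
          have h1 := h1 i (Finset.mem_range.1 hi)
          have h2 := h2 i (Finset.mem_range.1 hi)
          rw [sub_apply]
          by_cases h : 0 ≤ v i
          · simp only [h, decide_true, Bool.not_true, if_true, Bool.false_eq_true, if_false] at h1 h2
            rw [abs_of_nonneg h]
            nlinarith
          · simp only [h, decide_false, Bool.not_false, if_true, Bool.false_eq_true,
              if_false] at h1 h2
            rw [abs_of_neg (not_le.1 h)]
            nlinarith
      _ = (s - t) (∑ i ∈ Finset.range n, v i • x i) := by simp [map_sum]
      _ ≤ ‖s - t‖ * ‖∑ i ∈ Finset.range n, v i • x i‖ :=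
          (le_abs_self _).trans ((s - t).le_opNorm _)
      _ ≤ _ := by gcongr
  have hlim : (b - a) * ‖v‖ ≤ (2 * R) * ‖T v‖ :=
    le_of_tendsto_of_tendsto' ((hnorm v).tendsto_sum_nat.const_mul _)
      (((hsum v).hasSum.tendsto_sum_nat.norm).const_mul _) hpart
  rw [div_mul_eq_mul_div, div_le_iff₀ (by linarith)]
  nlinarith [norm_nonneg (T v)]

/-- If `X` contains no copy of `ℓ¹`, elements of the bidual are fragmented on bounded sets. -/
theorem exists_open_small_osc [CompleteSpace X] (d : ℕ → X) (hd : DenseRange d)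
    (hl1 : ¬ ∃ (T : lp (fun _ : ℕ => ℝ) 1 →L[ℝ] X) (c : ℝ), 0 < c ∧
      ∀ v : lp (fun _ : ℕ => ℝ) 1, c * ‖v‖ ≤ ‖T v‖)
    (f : (X →L[ℝ] ℝ) →L[ℝ] ℝ) (S : Set (X →L[ℝ] ℝ)) (hS : S.Nonempty) {R : ℝ}
    (hR : ∀ s ∈ S, ‖s‖ ≤ R) {ε : ℝ} (hε : 0 < ε) :
    ∃ U : Set (ℕ → ℝ), IsOpen U ∧ (S ∩ (fun y n => y (d n)) ⁻¹' U).Nonempty ∧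
      ∀ s ∈ S ∩ (fun y n => y (d n)) ⁻¹' U, ∀ t ∈ S ∩ (fun y n => y (d n)) ⁻¹' U,
        f s - f t < ε := by
  by_contra! hcon
  obtain ⟨S', a, b, hS', hne, hab, hgap⟩ := exists_gap_of_not_fragmented
    (fun (y : X →L[ℝ] ℝ) n => y (d n)) S hS f (‖f‖ * R) (fun s hs =>
      (f.le_opNorm s).trans (by gcongr; exact hR s hs)) hε hcon
  obtain ⟨x, hx, hind⟩ := exists_independent_of_gap d hd S' hne f
    (show 0 < (b - a) / 3 by linarith) hgap
  exact hl1 (exists_l1_embedding_of_independent x hx S' (fun s hs => hR s (hS' hs))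
    (by linarith) hind)

theorem exists_countable_stable {α β γ : Type*} [TopologicalSpace α] [SecondCountableTopology α]
    (e : β → α) (A : Set γ) (S : Set γ → Set β) (hS : Antitone S) :
    ∃ C₀ ⊆ A, C₀.Countable ∧ ∀ C ⊆ A, C.Countable → ∀ U, IsOpen U →
      (S C₀ ∩ e ⁻¹' U).Nonempty → (S (C₀ ∪ C) ∩ e ⁻¹' U).Nonempty := by
  have hex : ∀ b : Set α, ∃ C ⊆ A, C.Countable ∧ ((∃ C' ⊆ A, C'.Countable ∧
      ¬ (S C' ∩ e ⁻¹' b).Nonempty) → ¬ (S C ∩ e ⁻¹' b).Nonempty) := by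
    intro b
    by_cases h : ∃ C' ⊆ A, C'.Countable ∧ ¬ (S C' ∩ e ⁻¹' b).Nonempty
    · obtain ⟨C, h1, h2, h3⟩ := h
      exact ⟨C, h1, h2, fun _ => h3⟩
    · exact ⟨∅, empty_subset _, countable_empty, fun h' => absurd h' h⟩
  choose C hCA hCc hC using hex
  let B := TopologicalSpace.countableBasis α
  have hsub : (⋃ b ∈ B, C b) ⊆ A := iUnion₂_subset fun b _ => hCA b
  have hcount : (⋃ b ∈ B, C b).Countable :=
    (TopologicalSpace.countable_countableBasis α).biUnion fun b _ => hCc b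
  refine ⟨⋃ b ∈ B, C b, hsub, hcount, fun C' hC'A hC'c U hU => ?_⟩
  rintro ⟨s, hs, hsU⟩
  obtain ⟨b, hbB, hsb, hbU⟩ :=
    (TopologicalSpace.isBasis_countableBasis α).exists_subset_of_mem_open hsU hU
  by_contra hcon
  refine hC b ⟨_, union_subset hsub hC'A, hcount.union hC'c, fun h => hcon ?_⟩ ⟨s, ?_, hsb⟩
  · exact h.mono (inter_subset_inter_right _ (preimage_mono hbU))
  · exact hS (subset_biUnion_of_mem (u := C) hbB) hs

/-- Convex countable tightness of the weak-* topology on bounded subsets of the bidual. -/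
theorem exists_countable_annihilator [CompleteSpace X] (d : ℕ → X) (hd : DenseRange d)
    (hl1 : ¬ ∃ (T : lp (fun _ : ℕ => ℝ) 1 →L[ℝ] X) (c : ℝ), 0 < c ∧
      ∀ v : lp (fun _ : ℕ => ℝ) 1, c * ‖v‖ ≤ ‖T v‖)
    (A : Set ((X →L[ℝ] ℝ) →L[ℝ] ℝ)) {r : ℝ} (hA : ∀ g ∈ A, ‖g‖ ≤ r)
    (f : (X →L[ℝ] ℝ) →L[ℝ] ℝ)
    (hf : ∀ s : Finset (X →L[ℝ] ℝ), ∀ ε > 0, ∃ g ∈ A, ∀ y ∈ s, |g y - f y| < ε) :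
    ∃ C ⊆ A, C.Countable ∧ ∀ y, (∀ g ∈ C, g y = 0) → f y = 0 := by
  by_contra! hcon
  let S : ℕ → Set ((X →L[ℝ] ℝ) →L[ℝ] ℝ) → Set (X →L[ℝ] ℝ) := fun n C =>
    {y | ‖y‖ ≤ n ∧ f y = 1 ∧ ∀ g ∈ C, g y = 0}
  have hSanti : ∀ n, Antitone (S n) := fun n C C' h y hy =>
    ⟨hy.1, hy.2.1, fun g hg => hy.2.2 g (h hg)⟩
  obtain ⟨n, hn⟩ : ∃ n, ∀ C ⊆ A, C.Countable → (S n C).Nonempty := by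
    by_contra! hemp
    choose C hCA hCc hC using hemp
    obtain ⟨y, hy, hfy⟩ := hcon (⋃ n, C n) (iUnion_subset hCA) (countable_iUnion hCc)
    obtain ⟨n, hn⟩ := exists_nat_ge ‖(f y)⁻¹ • y‖
    have : (f y)⁻¹ • y ∈ S n (C n) := by
      refine ⟨hn, by simp [hfy], fun g hg => ?_⟩
      rw [map_smul, hy g (mem_iUnion.2 ⟨n, hg⟩), smul_zero]
    rw [hC] at this
    exact this
  let e : (X →L[ℝ] ℝ) → ℕ → ℝ := fun y n => y (d n)
  obtain ⟨C₀, hC₀A, hC₀c, hC₀⟩ := exists_countable_stable e A (S n) (hSanti n)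
  obtain ⟨m, hmS, hm⟩ : ∃ m : ℕ → X →L[ℝ] ℝ, (∀ i, m i ∈ S n C₀) ∧
      ∀ U : Set (ℕ → ℝ), IsOpen U → (S n C₀ ∩ e ⁻¹' U).Nonempty → ∃ i, e (m i) ∈ U := by
    have : Nonempty (e '' S n C₀) := ((hn C₀ hC₀A hC₀c).image e).to_subtype
    have hdense := TopologicalSpace.denseRange_denseSeq (e '' S n C₀)
    choose m hm1 hm2 using fun i => (TopologicalSpace.denseSeq (e '' S n C₀) i).2
    refine ⟨m, hm1, fun U hU ⟨s, hs, hsU⟩ => ?_⟩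
    obtain ⟨i, hi⟩ := hdense.exists_mem_open (hU.preimage continuous_subtype_val)
      ⟨⟨e s, s, hs, rfl⟩, hsU⟩
    refine ⟨i, ?_⟩
    rw [hm2]
    exact hi
  classical
  choose g hgA hg using fun k : ℕ => hf ((Finset.range k).image m) (1 / (k + 1 : ℝ))
    (by positivity)
  obtain ⟨h, -, hlim⟩ := exists_ultrafilter_limit (Ultrafilter.of (atTop : Filter ℕ)) g
    fun k => hA _ (hgA k)
  have hle : ((Ultrafilter.of (atTop : Filter ℕ)) : Filter ℕ) ≤ atTop := Ultrafilter.of_le _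
  have hhm : ∀ i, h (m i) = f (m i) := by
    intro i
    refine tendsto_nhds_unique (hlim (m i)) (Tendsto.mono_left ?_ hle)
    rw [tendsto_iff_dist_tendsto_zero]
    refine squeeze_zero' (Eventually.of_forall fun _ => dist_nonneg) ?_
      tendsto_one_div_add_atTop_nhds_zero_nat
    filter_upwards [eventually_gt_atTop i] with k hk
    rw [Real.dist_eq]
    exact (hg k _ (Finset.mem_image_of_mem m (Finset.mem_range.2 hk))).le
  obtain ⟨U, hU, hUne, hosc⟩ := exists_open_small_osc d hd hl1 (f - h) (S n C₀)
    (hn C₀ hC₀A hC₀c) (fun s hs => hs.1) one_pos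
  obtain ⟨s, hs, hsU⟩ := hC₀ (range g) (range_subset_iff.2 hgA) (countable_range g) U hU hUne
  obtain ⟨i, hi⟩ := hm U hU hUne
  have hhs : h s = 0 := by
    refine tendsto_nhds_unique (hlim s) ?_
    have : ∀ k, g k s = 0 := fun k => hs.2.2 _ (Or.inr ⟨k, rfl⟩)
    simp [this]
  have := hosc s ⟨hSanti n subset_union_left hs, hsU⟩ (m i) ⟨hmS i, hi⟩
  simp only [sub_apply, hhs, hhm, hs.2.1] at this
  norm_num at this

theorem hasCSP_dual_of_separable_of_no_l1 [CompleteSpace X] [TopologicalSpace.SeparableSpace X]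
    (hl1 : ¬ ∃ (T : lp (fun _ : ℕ => ℝ) 1 →L[ℝ] X) (c : ℝ), 0 < c ∧
      ∀ v : lp (fun _ : ℕ => ℝ) 1, c * ‖v‖ ≤ ‖T v‖) : HasCSP (X →L[ℝ] ℝ) := by
  intro F hF
  let d := TopologicalSpace.denseSeq X
  have hd : DenseRange d := TopologicalSpace.denseRange_denseSeq X
  let E : Submodule ℝ ((X →L[ℝ] ℝ) →L[ℝ] ℝ) :=
    { carrier := {f | ∃ C ⊆ F, C.Countable ∧ ∀ y, (∀ g ∈ C, g y = 0) → f y = 0}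
      zero_mem' := ⟨∅, empty_subset _, countable_empty, fun y _ => rfl⟩
      add_mem' := by
        rintro f g ⟨C, hC, hCc, h⟩ ⟨D, hD, hDc, h'⟩
        refine ⟨C ∪ D, union_subset hC hD, hCc.union hDc, fun y hy => ?_⟩
        rw [add_apply, h y fun g hg => hy g (Or.inl hg), h' y fun g hg => hy g (Or.inr hg),
          add_zero]
      smul_mem' := by
        rintro c f ⟨C, hC, hCc, h⟩
        refine ⟨C, hC, hCc, fun y hy => ?_⟩
        rw [smul_apply, h y hy, smul_zero] }
  have hE : ∀ φ, φ ∈ E := by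
    refine eq_top_of_total_of_bounded_closed E (fun r φ hφ => ?_) fun y hy => ?_
    · obtain ⟨C, hCA, hCc, hC⟩ := exists_countable_annihilator d hd hl1
        {ψ | ψ ∈ E ∧ ‖ψ‖ ≤ r} (fun g hg => hg.2) φ fun s ε hε => by
          obtain ⟨ψ, h1, h2, h3⟩ := hφ s ε hε
          exact ⟨ψ, ⟨h1, h2⟩, h3⟩
      have hex : ∀ g : C, ∃ D ⊆ F, D.Countable ∧
          ∀ y, (∀ f ∈ D, f y = 0) → (g : (X →L[ℝ] ℝ) →L[ℝ] ℝ) y = 0 := fun g => (hCA g.2).1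
      choose D hDF hDc hD using hex
      have := hCc.to_subtype
      refine ⟨⋃ g, D g, iUnion_subset hDF, countable_iUnion hDc, fun y hy => hC y fun g hg => ?_⟩
      exact hD ⟨g, hg⟩ y fun f hf => hy f (mem_iUnion.2 ⟨_, hf⟩)
    · by_contra hne
      obtain ⟨f, hf, hfy⟩ := hF y hne
      exact hfy (hy f ⟨{f}, by simpa using hf, countable_singleton f, fun y hy => hy f rfl⟩)
  choose C hCF hCc hC using fun n => hE (NormedSpace.inclusionInDoubleDual ℝ X (d n))
  refine ⟨⋃ n, C n, iUnion_subset hCF, countable_iUnion hCc, fun y hy => ?_⟩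
  by_contra! hcon
  refine hy (DFunLike.coe_injective (hd.equalizer y.continuous continuous_const ?_))
  ext n
  exact hC n y fun g hg => hcon g (mem_iUnion.2 ⟨n, hg⟩)

end Fragmentation

section CountableSeparation

theorem HasCSP.separableSpace_of_dual {X : Type*} [NormedAddCommGroup X] [NormedSpace ℝ X]
    (h : HasCSP (X →L[ℝ] ℝ)) : TopologicalSpace.SeparableSpace X := by
  obtain ⟨F₀, hF₀, hc, hsep⟩ := h (range (NormedSpace.inclusionInDoubleDual ℝ X)) fun f hf => by
    by_contra! hcon
    exact hf (ContinuousLinearMap.ext fun x => hcon _ ⟨x, rfl⟩)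
  choose! g hg using hF₀
  have hdense : closure (Submodule.span ℝ (g '' F₀) : Set X) = Set.univ := by
    refine eq_univ_of_forall fun x => ?_
    by_contra hx
    obtain ⟨f, hfx, hf⟩ := exists_functional_of_notMem_closure _ hx
    obtain ⟨Λ, hΛ, hne⟩ := hsep f (by rintro rfl; exact hfx rfl)
    refine hne ?_
    rw [← hg hΛ]
    exact hf _ (Submodule.subset_span (mem_image_of_mem g hΛ))
  have := ((hc.image g).isSeparable.span (R := ℝ)).closure
  rw [hdense] at this
  exact TopologicalSpace.isSeparable_univ_iff.1 this

theorem not_hasCSP_of_uncountable_family {Y Γ : Type*} [NormedAddCommGroup Y] [NormedSpace ℝ Y]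
    [Uncountable Γ] (y : Γ → Y) (hy : ∀ t, y t ≠ 0) {δ : ℝ} (hδ : 0 < δ)
    (hunc : ∀ C : Set Γ, ∀ u ∈ Submodule.span ℝ (y '' C), ∀ v ∈ Submodule.span ℝ (y '' Cᶜ),
      δ * ‖u‖ ≤ ‖u - v‖) : ¬ HasCSP Y := by
  intro h
  obtain ⟨F₀, hF₀, hc, hsep⟩ := h {f | {t | f (y t) ≠ 0}.Countable} fun x hx => by
    by_cases hcl : x ∈ closure (Submodule.span ℝ (range y) : Set Y)
    · obtain ⟨u, hu, hlim⟩ := mem_closure_iff_seq_limit.1 hcl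
      have hfin : ∀ n, ∃ D : Set Γ, D.Countable ∧ u n ∈ Submodule.span ℝ (y '' D) := fun n => by
        obtain ⟨l, hl⟩ := Finsupp.mem_span_range_iff_exists_finsupp.1 (hu n)
        refine ⟨l.support, l.support.countable_toSet, ?_⟩
        rw [← hl]
        exact Submodule.sum_mem _ fun t ht => Submodule.smul_mem _ _
          (Submodule.subset_span (mem_image_of_mem y ht))
      choose D hD huD using hfin
      have hx' : x ∉ closure (Submodule.span ℝ (y '' (⋃ n, D n)ᶜ) : Set Y) := by
        intro hx'
        have hle : δ * ‖x‖ ≤ 0 := by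
          obtain ⟨v, hv, hvlim⟩ := mem_closure_iff_seq_limit.1 hx'
          have h1 : Tendsto (fun n => δ * ‖u n‖) atTop (𝓝 (δ * ‖x‖)) := hlim.norm.const_mul δ
          have h2 : Tendsto (fun n => ‖u n - v n‖) atTop (𝓝 0) := by
            simpa using (hlim.sub hvlim).norm
          exact le_of_tendsto_of_tendsto' h1 h2 fun n => hunc _ _
            (Submodule.span_mono (image_mono (subset_iUnion D n)) (huD n)) _ (hv n)
        exact absurd hle (not_le.2 (mul_pos hδ (norm_pos_iff.2 hx)))
      obtain ⟨f, hfx, hf⟩ := exists_functional_of_notMem_closure _ hx'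
      refine ⟨f, (countable_iUnion hD).mono fun t ht => ?_, hfx⟩
      by_contra hcon
      exact ht (hf _ (Submodule.subset_span (mem_image_of_mem y hcon)))
    · obtain ⟨f, hfx, hf⟩ := exists_functional_of_notMem_closure _ hcl
      refine ⟨f, ?_, hfx⟩
      have : {t | f (y t) ≠ 0} = ∅ :=
        eq_empty_of_forall_notMem fun t ht => ht (hf _ (Submodule.subset_span ⟨t, rfl⟩))
      change {t | f (y t) ≠ 0}.Countable
      rw [this]
      exact countable_empty
  have hcount : (⋃ f ∈ F₀, {t | f (y t) ≠ 0}).Countable := hc.biUnion fun f hf => hF₀ hf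
  obtain ⟨t, ht⟩ : ∃ t, t ∉ ⋃ f ∈ F₀, {t | f (y t) ≠ 0} := by
    by_contra! hcon
    rw [eq_univ_of_forall hcon] at hcount
    exact not_countable (countable_univ_iff.1 hcount)
  obtain ⟨f, hf, hne⟩ := hsep (y t) (hy t)
  exact ht (mem_biUnion hf hne)

instance uncountable_set_nat : Uncountable (Set ℕ) := by
  rw [← not_countable_iff]
  intro h
  obtain ⟨f, hf⟩ := exists_injective_nat (Set ℕ)
  exact Function.cantor_injective f hf

/-- There is an independent family of sequences of signs indexed by the sets of integers. -/
theorem exists_independent_signs : ∃ z : Set ℕ → ℕ → ℝ, (∀ t n, |z t n| = 1) ∧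
    ∀ (s : Finset (Set ℕ)) (ε : Set ℕ → Prop) [DecidablePred ε],
      ∃ n, ∀ t ∈ s, z t n = if ε t then 1 else -1 := by
  classical
  obtain ⟨g, hg⟩ := exists_surjective_nat (Finset ℕ × Finset (Finset ℕ))
  refine ⟨fun t n => if (g n).1.filter (· ∈ t) ∈ (g n).2 then 1 else -1,
    fun t n => by dsimp only; split_ifs <;> simp, fun s ε _ => ?_⟩
  have hwit : ∀ t u : Set ℕ, ∃ k, t ≠ u → ¬ (k ∈ t ↔ k ∈ u) := fun t u => by
    by_cases h : t = u
    · exact ⟨0, fun h' => absurd h h'⟩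
    · by_contra! hcon
      exact h (Set.ext fun k => (hcon k).2)
  choose k hk using hwit
  let A : Finset ℕ := (s ×ˢ s).image fun p => k p.1 p.2
  obtain ⟨n, hn⟩ := hg (A, (s.filter ε).image fun t => A.filter (· ∈ t))
  refine ⟨n, fun t ht => ?_⟩
  have : A.filter (· ∈ t) ∈ (s.filter ε).image (fun t => A.filter (· ∈ t)) ↔ ε t := by
    constructor
    · intro h
      obtain ⟨u, hu, hut⟩ := Finset.mem_image.1 h
      rw [Finset.mem_filter] at hu
      by_cases htu : u = t
      · exact htu ▸ hu.2
      · refine absurd ?_ (hk u t htu)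
        have hA : k u t ∈ A := Finset.mem_image.2 ⟨(u, t), Finset.mk_mem_product hu.1 ht, rfl⟩
        have := congrArg (k u t ∈ ·) hut
        simpa [hA] using this
    · intro h
      exact Finset.mem_image_of_mem _ (Finset.mem_filter.2 ⟨ht, h⟩)
  simp only [hn, this]

/-- Bounded functionals on `ℓ¹` extend along an isomorphic embedding. -/
theorem exists_dual_extension {E X : Type*} [NormedAddCommGroup E] [NormedSpace ℝ E]
    [NormedAddCommGroup X] [NormedSpace ℝ X] (T : E →L[ℝ] X) {c : ℝ} (hc : 0 < c)
    (hT : ∀ v, c * ‖v‖ ≤ ‖T v‖) (ζ : E →L[ℝ] ℝ) :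
    ∃ y : X →L[ℝ] ℝ, (∀ v, y (T v) = ζ v) ∧ ‖y‖ ≤ ‖ζ‖ / c := by
  have hinj : Function.Injective T := by
    refine (injective_iff_map_eq_zero T).2 fun v hv => ?_
    have := hT v
    rw [hv, norm_zero] at this
    exact norm_le_zero_iff.1 (by nlinarith [norm_nonneg v])
  let e := LinearEquiv.ofInjective T.toLinearMap hinj
  have he : ∀ w, T (e.symm w) = w := fun w => congrArg Subtype.val (e.apply_symm_apply w)
  let φ : T.toLinearMap.range →L[ℝ] ℝ :=
    (ζ.toLinearMap ∘ₗ e.symm.toLinearMap).mkContinuous (‖ζ‖ / c) fun w => by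
      have h1 := hT (e.symm w)
      rw [he] at h1
      have h2 : ‖e.symm w‖ ≤ ‖w‖ / c := by
        rw [le_div_iff₀ hc, mul_comm]
        exact h1
      calc ‖ζ (e.symm w)‖ ≤ ‖ζ‖ * ‖e.symm w‖ := ζ.le_opNorm _
        _ ≤ ‖ζ‖ * (‖w‖ / c) := by gcongr
        _ = _ := by ring
  obtain ⟨y, hy, hyn⟩ := _root_.exists_extension_norm_eq _ φ
  refine ⟨y, fun v => ?_, ?_⟩
  · have := hy (e v)
    change y (T v) = ζ (e.symm (e v)) at this
    rwa [e.symm_apply_apply] at this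
  · rw [hyn]
    exact LinearMap.mkContinuous_norm_le _ (by positivity) _

theorem exists_l1_functional (z : ℕ → ℝ) (hz : ∀ n, |z n| = 1) :
    ∃ ζ : lp (fun _ : ℕ => ℝ) 1 →L[ℝ] ℝ, ‖ζ‖ ≤ 1 ∧
      ∀ n, ζ (lp.single 1 n (1 : ℝ)) = z n := by
  have hnorm : ∀ v : lp (fun _ : ℕ => ℝ) 1, HasSum (fun i => |v i|) ‖v‖ := fun v => by
    simpa using lp.hasSum_norm (p := 1) (by norm_num) v
  have hbound : ∀ (v : lp (fun _ : ℕ => ℝ) 1) i, ‖z i * v i‖ ≤ |v i| := fun v i => by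
    rw [Real.norm_eq_abs, abs_mul, hz, one_mul]
  have hsum : ∀ v : lp (fun _ : ℕ => ℝ) 1, Summable fun i => z i * v i := fun v =>
    Summable.of_norm_bounded (hnorm v).summable (hbound v)
  let ζ₀ : lp (fun _ : ℕ => ℝ) 1 →ₗ[ℝ] ℝ :=
    { toFun := fun v => ∑' i, z i * v i
      map_add' := fun v w => by
        rw [← (hsum v).tsum_add (hsum w)]
        simp [mul_add]
      map_smul' := fun c v => by
        rw [RingHom.id_apply, smul_eq_mul, ← tsum_mul_left]
        simp [mul_left_comm] }
  refine ⟨ζ₀.mkContinuous 1 fun v => ?_, LinearMap.mkContinuous_norm_le _ zero_le_one _,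
    fun n => ?_⟩
  · rw [one_mul]
    exact tsum_of_norm_bounded (hnorm v) (hbound v)
  · change ∑' i, z i * (lp.single 1 n (1 : ℝ) : lp (fun _ : ℕ => ℝ) 1) i = z n
    rw [tsum_eq_single n]
    · simp
    · intro i hi
      simp [hi]

theorem not_hasCSP_dual_of_l1_embedding {X : Type*} [NormedAddCommGroup X] [NormedSpace ℝ X]
    (T : lp (fun _ : ℕ => ℝ) 1 →L[ℝ] X) {c : ℝ} (hc : 0 < c)
    (hT : ∀ v : lp (fun _ : ℕ => ℝ) 1, c * ‖v‖ ≤ ‖T v‖) : ¬ HasCSP (X →L[ℝ] ℝ) := by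
  classical
  obtain ⟨z, hz, hind⟩ := exists_independent_signs
  choose ζ hζn hζ using fun t => exists_l1_functional (z t) (hz t)
  choose y hyT hyn using fun t => exists_dual_extension T hc hT (ζ t)
  have hyc : ∀ t, ‖y t‖ ≤ 1 / c := fun t => (hyn t).trans (by gcongr; exact hζn t)
  have hle : ∀ l : Set ℕ →₀ ℝ, ∑ t ∈ l.support, |l t| ≤
      ‖Finsupp.linearCombination ℝ y l‖ * ‖T‖ := by
    intro l
    obtain ⟨n, hn⟩ := hind l.support fun t => 0 ≤ l t
    have hen : ‖(lp.single 1 n (1 : ℝ) : lp (fun _ : ℕ => ℝ) 1)‖ = 1 := by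
      rw [lp.norm_single (by norm_num)]
      simp
    calc ∑ t ∈ l.support, |l t|
        = Finsupp.linearCombination ℝ y l (T (lp.single 1 n (1 : ℝ))) := by
          rw [Finsupp.linearCombination_apply, Finsupp.sum, sum_apply]
          refine Finset.sum_congr rfl fun t ht => ?_
          rw [smul_apply, hyT, hζ, hn t ht, smul_eq_mul]
          split_ifs with h
          · rw [abs_of_nonneg h, mul_one]
          · rw [abs_of_neg (not_le.1 h), mul_neg_one]
      _ ≤ ‖Finsupp.linearCombination ℝ y l‖ * ‖T (lp.single 1 n (1 : ℝ))‖ :=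
          (Real.le_norm_self _).trans (ContinuousLinearMap.le_opNorm _ _)
      _ ≤ ‖Finsupp.linearCombination ℝ y l‖ * ‖T‖ := by
          gcongr
          simpa [hen] using T.le_opNorm (lp.single 1 n (1 : ℝ))
  refine not_hasCSP_of_uncountable_family y (fun t ht => ?_)
    (show 0 < c / (‖T‖ + 1) by positivity) fun C u hu v hv => ?_
  · have := hyT t (lp.single 1 0 (1 : ℝ))
    rw [ht, hζ, zero_apply] at this
    have h1 := hz t 0
    rw [← this, abs_zero] at h1
    exact zero_ne_one h1
  · obtain ⟨l, hl, rfl⟩ := (Finsupp.mem_span_image_iff_linearCombination ℝ).1 hu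
    obtain ⟨m, hm, rfl⟩ := (Finsupp.mem_span_image_iff_linearCombination ℝ).1 hv
    have h1 : ‖Finsupp.linearCombination ℝ y l‖ ≤ (∑ t ∈ l.support, |l t|) * (1 / c) := by
      rw [Finsupp.linearCombination_apply, Finsupp.sum, Finset.sum_mul]
      refine norm_sum_le_of_le _ fun t _ => ?_
      rw [norm_smul, Real.norm_eq_abs]
      gcongr
      exact hyc t
    have hlm : ∀ t ∈ l.support, (l - m) t = l t := fun t ht => by
      have : m t = 0 := by
        by_contra h
        exact (Finsupp.mem_supported ℝ m).1 hm (Finsupp.mem_support_iff.2 h)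
          ((Finsupp.mem_supported ℝ l).1 hl ht)
      rw [Finsupp.sub_apply, this, sub_zero]
    have h2 : ∑ t ∈ l.support, |l t| ≤ ∑ t ∈ (l - m).support, |(l - m) t| := by
      rw [← Finset.sum_congr rfl fun t ht => congrArg abs (hlm t ht)]
      refine Finset.sum_le_sum_of_subset_of_nonneg (fun t ht => ?_) fun _ _ _ => abs_nonneg _
      rw [Finsupp.mem_support_iff, hlm t ht]
      exact Finsupp.mem_support_iff.1 ht
    have h3 := hle (l - m)
    rw [map_sub] at h3
    rw [mul_one_div, le_div_iff₀ hc] at h1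
    rw [div_mul_eq_mul_div, div_le_iff₀ (by positivity)]
    nlinarith [norm_nonneg (Finsupp.linearCombination ℝ y l - Finsupp.linearCombination ℝ y m)]

end CountableSeparation

/-- The dual of a Banach space `X` has CSP iff `X` is separable and contains no isomorphic
copy of `ℓ¹`. -/
theorem dual_hasCSP_iff (X : Type*) [NormedAddCommGroup X] [NormedSpace ℝ X]
    [CompleteSpace X] :
    HasCSP (X →L[ℝ] ℝ) ↔
      TopologicalSpace.SeparableSpace X ∧
        ¬ ∃ (T : lp (fun _ : ℕ => ℝ) 1 →L[ℝ] X) (c : ℝ), 0 < c ∧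
            ∀ v : lp (fun _ : ℕ => ℝ) 1, c * ‖v‖ ≤ ‖T v‖ := by
  refine ⟨fun h => ⟨h.separableSpace_of_dual, ?_⟩, ?_⟩
  · rintro ⟨T, c, hc, hT⟩
    exact not_hasCSP_dual_of_l1_embedding T hc hT h
  · rintro ⟨hsep, hl1⟩
    exact hasCSP_dual_of_separable_of_no_l1 hl1
end

section
/- Let K be a compact Hausdorff topological space that is scattered (every nonempty closed subset has a point isolated in that subset) and countably tight (for every A ⊆ K and every x in the closure of A there is a countable B ⊆ A with x in the closure of B). Then the Banach space C(K) of real-valued continuous functions on K with the supremum norm has the countable separation property (CSP) if and only if K is separable. -/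
open Set Cardinal Pointwise

open Filter Topology in
/-- If the functional `φ` keeps a uniform distance from the subspace `Y` on a family of vectors
tending to zero in norm, then some vector is annihilated by `Y` but not by `φ`. -/
theorem exists_annihilated_of_forall_exists_one_le {X : Type*} [NormedAddCommGroup X]
    [NormedSpace ℝ X] [CompleteSpace X] (Y : Submodule ℝ (X →L[ℝ] ℝ)) (φ : X →L[ℝ] ℝ) (J : Set X)
    (hJ : ∀ ε > 0, {x ∈ J | ε ≤ ‖x‖}.Finite)
    (hφ : ∀ y ∈ Y, ∃ x ∈ J, 1 ≤ |(φ - y) x|) :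
    ∃ x, (∀ y ∈ Y, y x = 0) ∧ φ x ≠ 0 := by
  classical
  obtain ⟨R, hR0, hR⟩ : ∃ R > 0, ∀ x ∈ J, ‖x‖ ≤ R := by
    obtain ⟨R, hR⟩ := ((hJ 1 one_pos).image norm).bddAbove
    refine ⟨max R 1, by positivity, fun x hx => ?_⟩
    by_cases h : 1 ≤ ‖x‖
    · exact (hR ⟨x, ⟨hx, h⟩, rfl⟩).trans (le_max_left _ _)
    · exact (not_le.1 h).le.trans (le_max_right _ _)
  have hmem : ∀ y : X →L[ℝ] ℝ, Memℓp (fun x : J => y x) ⊤ := fun y =>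
    memℓp_infty ⟨‖y‖ * R, by
      rintro _ ⟨x, rfl⟩
      exact (y.le_opNorm _).trans (by gcongr; exact hR _ x.2)⟩
  let T : (X →L[ℝ] ℝ) →ₗ[ℝ] lp (fun _ : J => ℝ) ⊤ :=
    { toFun := fun y => ⟨fun x => y x, hmem y⟩
      map_add' := fun _ _ => rfl
      map_smul' := fun _ _ => rfl }
  have hT : ∀ y x, (T y : J → ℝ) x = y x := fun _ _ => rfl
  have hnot : T φ ∉ (Y.map T).topologicalClosure := by
    intro h
    rw [← SetLike.mem_coe, Submodule.topologicalClosure_coe, Metric.mem_closure_iff] at h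
    obtain ⟨_, ⟨y, hy, rfl⟩, hd⟩ := h 1 one_pos
    obtain ⟨x, hx, h1⟩ := hφ y hy
    rw [dist_eq_norm, ← map_sub] at hd
    have := lp.norm_apply_le_norm ENNReal.top_ne_zero (T (φ - y)) ⟨x, hx⟩
    rw [hT, Real.norm_eq_abs] at this
    linarith
  obtain ⟨g, hg1, hg0⟩ : ∃ g : StrongDual ℝ (lp (fun _ : J => ℝ) ⊤),
      g (T φ) ≠ 0 ∧ ∀ y ∈ Y, g (T y) = 0 := by
    obtain ⟨g, u, hu, hu'⟩ := geometric_hahn_banach_closed_point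
      (Y.map T).topologicalClosure.convex (Submodule.isClosed_topologicalClosure _) hnot
    have hz : ∀ v ∈ Y.map T, g v = 0 := by
      intro v hv
      by_contra hne
      have h1 := hu ((u / g v) • v)
        (Submodule.smul_mem _ _ (Submodule.le_topologicalClosure _ hv))
      rw [map_smul, smul_eq_mul, div_mul_cancel₀ _ hne] at h1
      exact lt_irrefl _ h1
    refine ⟨g, ?_, fun y hy => hz _ ⟨y, hy, rfl⟩⟩
    have := hu 0 (Submodule.zero_mem _)
    rw [map_zero] at this
    exact (this.trans hu').ne'
  let e : J → lp (fun _ : J => ℝ) ⊤ := fun x => lp.single ⊤ x 1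
  have hsum : Summable fun x : J => ‖g (e x)‖ := by
    refine summable_of_sum_le (c := ‖g‖) (fun _ => norm_nonneg _) fun s => ?_
    have h1 : ∑ x ∈ s, ‖g (e x)‖ = g (∑ x ∈ s, (SignType.sign (g (e x)) : ℝ) • e x) := by
      rw [map_sum]
      refine Finset.sum_congr rfl fun x _ => ?_
      rw [map_smul, smul_eq_mul, sign_mul_self, Real.norm_eq_abs]
    rw [h1]
    refine (le_abs_self _).trans ((g.le_opNorm _).trans ?_)
    refine mul_le_of_le_one_right (norm_nonneg _) (lp.norm_le_of_forall_le zero_le_one fun x => ?_)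
    rw [lp.coeFn_sum, Finset.sum_apply]
    simp only [lp.coeFn_smul, Pi.smul_apply, e, lp.single_apply, Pi.single_apply, smul_eq_mul,
      mul_ite, mul_one, mul_zero, Finset.sum_ite_eq]
    split_ifs
    · rcases SignType.sign (g (lp.single ⊤ x 1)) with _ | _ | _ <;> simp
    · simp
  have hsumX : Summable fun x : J => g (e x) • (x : X) := by
    refine Summable.of_norm_bounded (hsum.mul_right R) fun x => ?_
    rw [norm_smul]
    gcongr
    exact hR _ x.2
  have key : ∀ y : X →L[ℝ] ℝ, HasSum (fun x : J => g (e x) • y x) (g (T y)) := by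
    intro y
    have h1 : HasSum (fun x : J => y x • e x) (T y) := by
      rw [HasSum, SummationFilter.unconditional_filter, Metric.tendsto_atTop]
      intro ε hε
      have hε' : 0 < ε / (2 * (‖y‖ + 1)) := by positivity
      refine ⟨((hJ _ hε').preimage Subtype.val_injective.injOn).toFinset, fun s hs => ?_⟩
      rw [dist_eq_norm]
      refine lt_of_le_of_lt (lp.norm_le_of_forall_le (C := ε / 2) (by positivity) fun x => ?_)
        (by linarith)
      rw [lp.coeFn_sub, Pi.sub_apply, lp.coeFn_sum, Finset.sum_apply, hT]
      simp only [lp.coeFn_smul, Pi.smul_apply, e, lp.single_apply, Pi.single_apply, smul_eq_mul,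
        mul_ite, mul_one, mul_zero, Finset.sum_ite_eq]
      split_ifs with hx
      · simp; positivity
      · rw [zero_sub, norm_neg]
        have hx' : ‖(x : X)‖ < ε / (2 * (‖y‖ + 1)) := by
          by_contra hc
          exact hx (hs (by simpa using not_lt.1 hc))
        refine (y.le_opNorm _).trans ?_
        rw [lt_div_iff₀ (by positivity)] at hx'
        nlinarith [norm_nonneg y, norm_nonneg (x : X)]
    have h2 := g.hasSum h1
    simpa [mul_comm] using h2
  have hval : ∀ y : X →L[ℝ] ℝ, y (∑' x : J, g (e x) • (x : X)) = g (T y) := by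
    intro y
    have h1 := y.hasSum hsumX.hasSum
    simp only [map_smul] at h1
    exact h1.unique (key y)
  exact ⟨_, fun y hy => by rw [hval, hg0 y hy], by rwa [hval]⟩

open Topology in
/-- **Krein–Šmulian theorem** for subspaces: a subspace of the dual of a Banach space which meets
every closed ball in a weak-* closed set and separates points is the whole dual. -/
theorem Submodule.eq_top_of_isClosed_weakDual_inter_closedBall {X : Type*} [NormedAddCommGroup X]
    [NormedSpace ℝ X] [CompleteSpace X] (Y : Submodule ℝ (X →L[ℝ] ℝ))
    (hY : ∀ r : ℝ, IsClosed {w : WeakDual ℝ X | WeakDual.toStrongDual w ∈ Y ∧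
      ‖WeakDual.toStrongDual w‖ ≤ r})
    (hsep : ∀ x, (∀ y ∈ Y, y x = 0) → x = 0) : Y = ⊤ := by
  classical
  rw [eq_top_iff']
  intro φ
  by_contra hφ
  have hclosure : φ ∉ closure (Y : Set (X →L[ℝ] ℝ)) := by
    intro h
    have h1 := (hY (‖φ‖ + 1)).preimage
      (NormedSpace.Dual.toWeakDual_continuous (𝕜 := ℝ) (E := X))
    have h2 : φ ∈ closure (Metric.ball 0 (‖φ‖ + 1) ∩ (Y : Set (X →L[ℝ] ℝ))) :=
      Metric.isOpen_ball.inter_closure ⟨by simp, h⟩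
    have h3 : Metric.ball 0 (‖φ‖ + 1) ∩ (Y : Set (X →L[ℝ] ℝ)) ⊆
        {y | y ∈ Y ∧ ‖y‖ ≤ ‖φ‖ + 1} :=
      fun y hy => ⟨hy.2, (mem_ball_zero_iff.1 hy.1).le⟩
    have h4 : φ ∈ {y | y ∈ Y ∧ ‖y‖ ≤ ‖φ‖ + 1} := closure_minimal h3 h1 h2
    exact hφ h4.1
  obtain ⟨δ, hδ, hdist⟩ : ∃ δ > 0, ∀ y ∈ Y, δ ≤ ‖φ - y‖ := by
    rw [Metric.mem_closure_iff] at hclosure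
    push Not at hclosure
    simpa only [dist_eq_norm, SetLike.mem_coe] using hclosure
  let T : ℝ → Set (WeakDual ℝ X) := fun r =>
    {w | φ - WeakDual.toStrongDual w ∈ Y ∧ ‖WeakDual.toStrongDual w‖ ≤ r}
  have hTc : ∀ r, IsCompact (T r) := by
    intro r
    have hcont : Continuous fun w : WeakDual ℝ X => StrongDual.toWeakDual φ - w :=
      continuous_const.sub continuous_id
    have h1 := (WeakDual.isCompact_closedBall (𝕜 := ℝ) (E := X) 0 r).inter_right
      ((hY (‖φ‖ + r)).preimage hcont)
    convert h1 using 1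
    ext w
    simp only [T, mem_ofPred_eq, mem_inter_iff, mem_preimage, mem_closedBall_zero_iff, map_sub]
    refine ⟨fun h => ⟨h.2, h.1, (norm_sub_le _ _).trans ?_⟩, fun h => ⟨h.2.1, h.1⟩⟩
    exact add_le_add le_rfl h.2
  let P : ℕ → Finset X → Prop := fun n S => ∀ w ∈ T (δ / 2 * (n + 1)), ∃ x ∈ S, 1 < |w x|
  have hP0 : P 0 ∅ := by
    intro w hw
    have h1 := hdist _ hw.1
    rw [sub_sub_cancel] at h1
    have h2 := hw.2
    push_cast at h2
    linarith
  have hstep : ∀ n S, P n S → ∃ S', P (n + 1) S' ∧ S ⊆ S' ∧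
      ∀ x ∈ S', x ∉ S → ‖x‖ ≤ (δ / 2 * (n + 1))⁻¹ := by
    intro n S hS
    have hr : 0 < δ / 2 * (n + 1) := by positivity
    let I : Set X := ↑S ∪ Metric.closedBall 0 (δ / 2 * (n + 1))⁻¹
    obtain ⟨t, htI, htf, ht⟩ := (hTc (δ / 2 * ((n + 1 : ℕ) + 1))).elim_finite_subcover_image
      (b := I) (c := fun x => {w : WeakDual ℝ X | 1 < |w x|})
      (fun x _ => isOpen_lt continuous_const (WeakDual.eval_continuous x).abs) (by
        intro w hw
        rw [mem_iUnion₂]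
        by_cases hwr : ‖WeakDual.toStrongDual w‖ ≤ δ / 2 * (n + 1)
        · obtain ⟨x, hx, h1⟩ := hS w ⟨hw.1, hwr⟩
          exact ⟨x, Or.inl hx, h1⟩
        · by_contra hcon
          push Not at hcon
          refine hwr (ContinuousLinearMap.opNorm_le_of_unit_norm hr.le fun x hx => ?_)
          have h1 : |w ((δ / 2 * (n + 1))⁻¹ • x)| ≤ 1 := by
            refine not_lt.1 fun h => hcon _ (Or.inr ?_) h
            rw [mem_closedBall_zero_iff, norm_smul, hx, mul_one, Real.norm_of_nonneg (by positivity)]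
          rw [map_smul, smul_eq_mul, abs_mul, abs_of_pos (by positivity),
            inv_mul_le_iff₀ hr, mul_one] at h1
          exact h1)
    refine ⟨S ∪ htf.toFinset, fun w hw => ?_, Finset.subset_union_left, fun x hx hxS => ?_⟩
    · obtain ⟨x, hx, h1⟩ := mem_iUnion₂.1 (ht hw)
      exact ⟨x, Finset.mem_union_right _ (htf.mem_toFinset.2 hx), h1⟩
    · rw [Finset.mem_union, htf.mem_toFinset] at hx
      have hxt := hx.resolve_left hxS
      exact mem_closedBall_zero_iff.1 ((htI hxt).resolve_left hxS)
  choose! g hg1 hg2 hg3 using hstep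
  let S : ℕ → Finset X := fun n => Nat.rec ∅ g n
  have hS : ∀ n, P n (S n) := fun n => Nat.rec hP0 (fun n ih => hg1 n _ ih) n
  have hSmono : Monotone S := monotone_nat_of_le_succ fun n => hg2 n _ (hS n)
  have hSsmall : ∀ n, ∀ x ∈ S (n + 1), x ∉ S n → ‖x‖ ≤ (δ / 2 * (n + 1))⁻¹ :=
    fun n => hg3 n _ (hS n)
  obtain ⟨x, hx0, hx1⟩ := exists_annihilated_of_forall_exists_one_le Y φ {x | ∃ n, x ∈ S n} (by
    intro ε hε
    obtain ⟨N, hN⟩ := exists_nat_gt (2 / (δ * ε))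
    refine (S N).finite_toSet.subset ?_
    rintro x ⟨⟨n, hn⟩, hxε⟩
    by_contra hxN
    have hind : ∀ k, x ∉ S (N + k) := by
      intro k
      induction k with
      | zero => exact hxN
      | succ k ih =>
        intro hk
        have h1 := hSsmall (N + k) x hk ih
        have h2 : (δ / 2 * ((N + k : ℕ) + 1))⁻¹ < ε := by
          rw [inv_lt_comm₀ (by positivity) hε, ← one_div, div_lt_iff₀ hε]
          rw [div_lt_iff₀ (by positivity)] at hN
          push_cast
          nlinarith [mul_pos hδ hε, (Nat.cast_nonneg k : (0 : ℝ) ≤ k)]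
        linarith
    exact hind n (hSmono (Nat.le_add_left n N) hn)) (by
    intro y hy
    obtain ⟨n, hn⟩ := exists_nat_gt (‖φ - y‖ / (δ / 2))
    rw [div_lt_iff₀ (by positivity)] at hn
    obtain ⟨x, hx, h1⟩ := hS n (StrongDual.toWeakDual (φ - y))
      ⟨by simpa using hy, hn.le.trans (by nlinarith)⟩
    exact ⟨x, ⟨n, hx⟩, h1.le⟩)
  exact hx1 (by rw [hsep x hx0, map_zero])

open Filter Topology in
/-- A closed subspace of a complete space is everything as soon as every nonzero vector splits off
a nonzero piece in the subspace additively in norm. -/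
theorem Submodule.eq_top_of_forall_exists_norm_sub_add_norm_le {E : Type*} [NormedAddCommGroup E]
    [NormedSpace ℝ E] [CompleteSpace E] (W : Submodule ℝ E) (hW : IsClosed (W : Set E))
    (h : ∀ v : E, v ≠ 0 → ∃ w ∈ W, w ≠ 0 ∧ ‖v - w‖ + ‖w‖ ≤ ‖v‖) : W = ⊤ := by
  rw [eq_top_iff']
  intro φ
  let R : E → Set E := fun v => {v' | v - v' ∈ W ∧ ‖v'‖ + ‖v - v'‖ ≤ ‖v‖}
  have hrefl : ∀ v, v ∈ R v := fun v => by simp [R]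
  have htrans : ∀ u v w, v ∈ R u → w ∈ R v → w ∈ R u := by
    intro u v w hv hw
    refine ⟨by simpa using W.add_mem hv.1 hw.1, ?_⟩
    have := norm_add_le (u - v) (v - w)
    rw [sub_add_sub_cancel] at this
    linarith [hv.2, hw.2]
  have hclosed : ∀ v, IsClosed (R v) := fun v =>
    (hW.preimage (continuous_const.sub continuous_id)).inter
      (isClosed_le (continuous_norm.add (continuous_const.sub continuous_id).norm)
        continuous_const)
  have hnext : ∀ (n : ℕ) v, ∃ v' ∈ R v, ∀ u ∈ R v, ‖v'‖ ≤ ‖u‖ + ((n : ℝ) + 1)⁻¹ := by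
    intro n v
    have hne : (norm '' R v).Nonempty := ⟨_, v, hrefl v, rfl⟩
    have hbdd : BddBelow (norm '' R v) := ⟨0, by rintro _ ⟨u, -, rfl⟩; exact norm_nonneg u⟩
    obtain ⟨_, ⟨v', hv', rfl⟩, hlt⟩ := Real.lt_sInf_add_pos hne
      (ε := ((n : ℝ) + 1)⁻¹) (by positivity)
    exact ⟨v', hv', fun u hu => hlt.le.trans (by gcongr; exact csInf_le hbdd ⟨u, hu, rfl⟩)⟩
  choose! g hg1 hg2 using hnext
  let s : ℕ → E := fun n => Nat.rec φ g n
  have hs : ∀ m n, m ≤ n → s n ∈ R (s m) := by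
    intro m n hmn
    induction n, hmn using Nat.le_induction with
    | base => exact hrefl _
    | succ n _ ih => exact htrans _ _ _ ih (hg1 n _)
  have hanti : Antitone fun n => ‖s n‖ := fun m n hmn => by
    linarith [(hs m n hmn).2, norm_nonneg (s m - s n)]
  have hconv := tendsto_atTop_ciInf hanti ⟨0, by rintro _ ⟨n, rfl⟩; exact norm_nonneg _⟩
  have hcauchy : CauchySeq s := by
    have h1 := hconv.cauchySeq
    rw [Metric.cauchySeq_iff'] at h1 ⊢
    intro ε hε
    obtain ⟨N, hN⟩ := h1 ε hε
    refine ⟨N, fun n hn => ?_⟩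
    have h2 := hN n hn
    rw [Real.dist_eq, abs_sub_comm] at h2
    rw [dist_comm, dist_eq_norm]
    linarith [le_abs_self (‖s N‖ - ‖s n‖), (hs N n hn).2]
  obtain ⟨v, hv⟩ := cauchySeq_tendsto_of_complete hcauchy
  have hvR : ∀ n, v ∈ R (s n) := fun n =>
    (hclosed _).mem_of_tendsto hv (eventually_atTop.2 ⟨n, fun m hm => hs n m hm⟩)
  have hmin : ∀ u ∈ R v, ‖v‖ ≤ ‖u‖ := by
    intro u hu
    refine le_of_forall_pos_le_add fun ε hε => ?_
    obtain ⟨n, hn⟩ := exists_nat_one_div_lt hε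
    have h1 := hg2 n (s n) u (htrans _ _ _ (hvR n) hu)
    have h2 := (hvR (n + 1)).2
    have h3 : ‖s (n + 1)‖ ≤ ‖u‖ + ((n : ℝ) + 1)⁻¹ := h1
    rw [one_div] at hn
    linarith [norm_nonneg (s (n + 1) - v)]
  have hv0 : v = 0 := by
    by_contra hne
    obtain ⟨w, hw, hw0, hle⟩ := h v hne
    have h1 := hmin (v - w) ⟨by simpa using hw, by simpa using hle⟩
    linarith [norm_pos_iff.2 hw0]
  have := (hvR 0).1
  rw [hv0, sub_zero] at this
  exact this

/-- A scattered T₁ space is totally disconnected. -/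
theorem totallyDisconnectedSpace_of_scattered {K : Type*} [TopologicalSpace K] [T1Space K]
    (hscat : ∀ S : Set K, S.Nonempty → IsClosed S →
      ∃ x ∈ S, ∃ U : Set K, IsOpen U ∧ U ∩ S = {x}) : TotallyDisconnectedSpace K := by
  rw [totallyDisconnectedSpace_iff_connectedComponent_subsingleton]
  intro a
  obtain ⟨x, hx, U, hU, hUx⟩ := hscat (connectedComponent a) ⟨a, mem_connectedComponent⟩
    isClosed_connectedComponent
  have h1 : connectedComponent a ⊆ {x} := by
    have hpre := (isPreconnected_connectedComponent (x := a))
    rw [isPreconnected_iff_subset_of_disjoint] at hpre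
    have hx' : x ∈ U := (hUx.symm.subset rfl).1
    rcases hpre U {x}ᶜ hU isClosed_singleton.isOpen_compl
      (fun y _ => by
        by_cases hy : y = x
        · exact Or.inl (hy ▸ hx')
        · exact Or.inr hy)
      (by
        ext y
        simp only [mem_inter_iff, mem_compl_iff, mem_singleton_iff, mem_empty_iff_false, iff_false]
        rintro ⟨hy, hyU, hne⟩
        exact hne (hUx.subset ⟨hyU, hy⟩)) with h | h
    · exact fun y hy => hUx.subset ⟨h hy, hy⟩
    · exact absurd rfl (h hx)
  exact subsingleton_singleton.anti h1

open Topology in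
/-- A point mass can be split off any nonzero functional on `C(K)`, additively in norm, when `K` is
scattered. -/
theorem exists_smul_evalCLM_norm_sub_add_norm_le {K : Type*} [TopologicalSpace K] [CompactSpace K]
    [T2Space K]
    (hscat : ∀ S : Set K, S.Nonempty → IsClosed S →
      ∃ x ∈ S, ∃ U : Set K, IsOpen U ∧ U ∩ S = {x})
    (ψ : C(K, ℝ) →L[ℝ] ℝ) (hψ : ψ ≠ 0) :
    ∃ (x : K) (c : ℝ), c • ContinuousMap.evalCLM (M := ℝ) ℝ x ≠ 0 ∧
      ‖ψ - c • ContinuousMap.evalCLM (M := ℝ) ℝ x‖ +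
        ‖c • ContinuousMap.evalCLM (M := ℝ) ℝ x‖ ≤ ‖ψ‖ := by
  classical
  have := totallyDisconnectedSpace_of_scattered hscat
  have hχ : ∀ V : Set K, IsClopen V → ∃ χ : C(K, ℝ), (∀ x ∈ V, χ x = 1) ∧ ∀ x ∉ V, χ x = 0 :=
    fun V hV => ⟨⟨V.indicator fun _ => 1, hV.continuous_indicator continuous_const⟩,
      fun x hx => indicator_of_mem hx fun _ => (1 : ℝ),
      fun x hx => indicator_of_notMem hx fun _ => (1 : ℝ)⟩
  let Null : Set K → Prop := fun V => ∀ f : C(K, ℝ), (∀ x ∉ V, f x = 0) → ψ f = 0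
  let N : Set K := {x | ∃ V, IsClopen V ∧ x ∈ V ∧ Null V}
  have hN : ∀ T : Set K, IsCompact T → T ⊆ N → ∃ V, IsClopen V ∧ T ⊆ V ∧ Null V := by
    intro T hT hTN
    refine hT.induction_on (p := fun T => ∃ V, IsClopen V ∧ T ⊆ V ∧ Null V) ?_ ?_ ?_ ?_
    · exact ⟨∅, isClopen_empty, Subset.rfl, fun f hf => by
        rw [show f = 0 from ContinuousMap.ext fun x => hf x (notMem_empty x), map_zero]⟩
    · rintro s t hst ⟨V, hV, htV, hnull⟩
      exact ⟨V, hV, hst.trans htV, hnull⟩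
    · rintro s t ⟨V, hV, hsV, hVnull⟩ ⟨V', hV', htV', hV'null⟩
      refine ⟨V ∪ V', hV.union hV', union_subset_union hsV htV', fun f hf => ?_⟩
      obtain ⟨χ, hχ1, hχ0⟩ := hχ V hV
      have h1 : ψ (χ * f) = 0 := hVnull _ fun x hx => by simp [hχ0 x hx]
      have h2 : ψ (f - χ * f) = 0 := hV'null _ fun x hx => by
        by_cases hxV : x ∈ V
        · simp [hχ1 x hxV]
        · simp [hf x fun h => h.elim hxV hx]
      rwa [map_sub, h1, sub_zero] at h2
    · intro x hx
      obtain ⟨V, hV, hxV, hnull⟩ := hTN hx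
      exact ⟨V, mem_nhdsWithin_of_mem_nhds (hV.isOpen.mem_nhds hxV), V, hV, Subset.rfl, hnull⟩
  have hNopen : IsOpen N := by
    rw [isOpen_iff_forall_mem_open]
    rintro x ⟨V, hV, hx, hnull⟩
    exact ⟨V, fun y hy => ⟨V, hV, hy, hnull⟩, hV.isOpen, hx⟩
  have hNne : Nᶜ.Nonempty := by
    rw [nonempty_compl]
    intro h
    obtain ⟨V, -, hV, hnull⟩ := hN univ isCompact_univ h.ge
    exact hψ (ContinuousLinearMap.ext fun f => hnull f fun x hx => absurd (hV (mem_univ x)) hx)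
  obtain ⟨x, hxN, U, hU, hUx⟩ := hscat Nᶜ hNne hNopen.isClosed_compl
  obtain ⟨V, hV, hxV, hVU⟩ := compact_exists_isClopen_in_isOpen hU (hUx.symm.subset rfl).1
  obtain ⟨χ, hχ1, hχ0⟩ := hχ V hV
  have hval : ∀ f : C(K, ℝ), ψ (χ * f) = f x * ψ χ := by
    intro f
    obtain ⟨g, hg⟩ : ∃ g : C(K, ℝ), g = χ * f - f x • χ := ⟨_, rfl⟩
    suffices h : ψ g = 0 by
      rw [hg, map_sub, map_smul, smul_eq_mul, sub_eq_zero] at h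
      exact h
    have hgV : ∀ y ∉ V, g y = 0 := fun y hy => by simp [hg, hχ0 y hy]
    have hgx : g x = 0 := by simp [hg, hχ1 x hxV]
    have hbound : ∀ ε > 0, ‖ψ g‖ ≤ ‖ψ‖ * ε := by
      intro ε hε
      obtain ⟨V', hV', hxV', hV'g⟩ := compact_exists_isClopen_in_isOpen
        (isOpen_lt g.continuous.abs (continuous_const (y := ε))) (x := x) (by simpa [hgx] using hε)
      obtain ⟨V'', hV'', hsub, hnull⟩ := hN (V \ V') (hV.diff hV').isClosed.isCompact (by
        rintro y ⟨hyV, hyV'⟩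
        by_contra hyN
        have h1 : y ∈ ({x} : Set K) := hUx.subset ⟨hVU hyV, hyN⟩
        exact hyV' (h1 ▸ hxV'))
      obtain ⟨ξ, hξ1, hξ0⟩ := hχ V'' hV''
      have h1 : ψ (ξ * g) = 0 := hnull _ fun y hy => by simp [hξ0 y hy]
      have h2 : ψ g = ψ (g - ξ * g) := by rw [map_sub, h1, sub_zero]
      rw [h2]
      refine (ψ.le_opNorm _).trans (mul_le_mul_of_nonneg_left ?_ (norm_nonneg _))
      refine (ContinuousMap.norm_le _ hε.le).2 fun y => ?_
      by_cases hy : y ∈ V''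
      · simpa [hξ1 y hy] using hε.le
      · have h3 : (g - ξ * g) y = g y := by simp [hξ0 y hy]
        rw [h3]
        by_cases hyV : y ∈ V
        · have : y ∈ V' := by
            by_contra h
            exact hy (hsub ⟨hyV, h⟩)
          exact (hV'g this).le
        · simpa [hgV y hyV] using hε.le
    by_contra hne
    have hpos : 0 < ‖ψ g‖ := norm_pos_iff.2 hne
    have h0 : 0 < ‖ψ‖ + 1 := add_pos_of_nonneg_of_pos (ψ.opNorm_nonneg) one_pos
    have h1 := hbound (‖ψ g‖ / (‖ψ‖ + 1)) (by positivity)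
    rw [mul_div_assoc', le_div_iff₀ h0] at h1
    nlinarith
  have hc : ψ χ ≠ 0 := by
    intro hc
    refine hxN ⟨V, hV, hxV, fun f hf => ?_⟩
    have h1 : f = χ * f := by
      ext y
      by_cases hy : y ∈ V
      · simp [hχ1 y hy]
      · simp [hf y hy]
    rw [h1, hval, hc, mul_zero]
  have hcle : |ψ χ| ≤ ‖ψ‖ := by
    refine (ψ.le_opNorm χ).trans (mul_le_of_le_one_right (norm_nonneg _) ?_)
    refine (ContinuousMap.norm_le _ zero_le_one).2 fun y => ?_
    by_cases hy : y ∈ V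
    · simp [hχ1 y hy]
    · simp [hχ0 y hy]
  refine ⟨x, ψ χ, fun h => hc ?_, ?_⟩
  · simpa [hχ1 x hxV] using DFunLike.congr_fun h χ
  · have h1 : ‖ψ χ • ContinuousMap.evalCLM (M := ℝ) ℝ x‖ ≤ |ψ χ| := by
      refine ContinuousLinearMap.opNorm_le_bound _ (abs_nonneg _) fun f => ?_
      rw [smul_apply, smul_eq_mul, norm_mul, Real.norm_eq_abs (ψ χ)]
      exact mul_le_mul_of_nonneg_left (f.norm_coe_le_norm x) (abs_nonneg _)
    have h2 : ‖ψ - ψ χ • ContinuousMap.evalCLM (M := ℝ) ℝ x‖ ≤ ‖ψ‖ - |ψ χ| := by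
      refine ContinuousLinearMap.opNorm_le_bound _ (sub_nonneg.2 hcle) fun f => ?_
      have h3 : (ψ - ψ χ • ContinuousMap.evalCLM (M := ℝ) ℝ x) f = ψ (f - χ * f) := by
        rw [map_sub, hval]
        simp [mul_comm]
      rw [h3, sub_mul, le_sub_iff_add_le]
      have h4 : ∀ a b : ℝ, |a| ≤ 1 → |b| ≤ 1 →
          a * ψ (f - χ * f) + b * (‖f‖ * ψ χ) ≤ ‖ψ‖ * ‖f‖ := by
        intro a b ha hb
        have h5 : a * ψ (f - χ * f) + b * (‖f‖ * ψ χ) =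
            ψ (a • (f - χ * f) + (b * ‖f‖) • χ) := by
          simp only [map_add, map_smul, smul_eq_mul, mul_assoc]
        rw [h5]
        refine (le_abs_self _).trans ((ψ.le_opNorm _).trans
          (mul_le_mul_of_nonneg_left ?_ (norm_nonneg _)))
        refine (ContinuousMap.norm_le _ (norm_nonneg _)).2 fun y => ?_
        by_cases hy : y ∈ V
        · simp only [ContinuousMap.add_apply, ContinuousMap.smul_apply, ContinuousMap.sub_apply,
            ContinuousMap.mul_apply, hχ1 y hy, smul_eq_mul]
          rw [one_mul, sub_self, mul_zero, zero_add, mul_one, norm_mul, norm_norm]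
          exact mul_le_of_le_one_left (norm_nonneg _) hb
        · simp only [ContinuousMap.add_apply, ContinuousMap.smul_apply, ContinuousMap.sub_apply,
            ContinuousMap.mul_apply, hχ0 y hy, smul_eq_mul]
          rw [zero_mul, sub_zero, mul_zero, add_zero, norm_mul]
          exact (mul_le_of_le_one_left (norm_nonneg _) ha).trans (f.norm_coe_le_norm y)
      have h6 : ∀ r : ℝ, ∃ a : ℝ, |a| ≤ 1 ∧ |r| = a * r := fun r => by
        rcases abs_choice r with h | h
        · exact ⟨1, by simp, by rw [h, one_mul]⟩
        · exact ⟨-1, by simp, by rw [h, neg_one_mul]⟩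
      obtain ⟨a, ha, ha'⟩ := h6 (ψ (f - χ * f))
      obtain ⟨b, hb, hb'⟩ := h6 (ψ χ)
      rw [Real.norm_eq_abs, ha', hb']
      linarith [h4 a b ha hb]
    linarith

/-- On a scattered compact Hausdorff space, the point evaluations span a norm-dense subspace of the
dual of `C(K)`. -/
theorem topologicalClosure_span_range_evalCLM_eq_top {K : Type*} [TopologicalSpace K]
    [CompactSpace K] [T2Space K]
    (hscat : ∀ S : Set K, S.Nonempty → IsClosed S →
      ∃ x ∈ S, ∃ U : Set K, IsOpen U ∧ U ∩ S = {x}) :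
    (Submodule.span ℝ (range fun x : K => (ContinuousMap.evalCLM ℝ x :
      C(K, ℝ) →L[ℝ] ℝ))).topologicalClosure = ⊤ := by
  refine Submodule.eq_top_of_forall_exists_norm_sub_add_norm_le (E := C(K, ℝ) →L[ℝ] ℝ) _
    (Submodule.isClosed_topologicalClosure _) fun ψ hψ => ?_
  obtain ⟨x, c, h0, h1⟩ := exists_smul_evalCLM_norm_sub_add_norm_le hscat ψ hψ
  exact ⟨_, Submodule.le_topologicalClosure _
    (Submodule.smul_mem _ c (Submodule.subset_span ⟨x, rfl⟩)), h0, h1⟩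

open Topology in
/-- Countable tightness lifts along a map from a compact Hausdorff space to a countably tight one
with countably tight fibers. -/
theorem exists_countable_mem_closure_of_fibers {X Y : Type*} [TopologicalSpace X]
    [TopologicalSpace Y] [CompactSpace X] [T2Space X] [T2Space Y] (f : X → Y) (hf : Continuous f)
    (hY : ∀ A : Set Y, ∀ y ∈ closure A, ∃ B ⊆ A, B.Countable ∧ y ∈ closure B)
    (hfib : ∀ y, ∀ A ⊆ f ⁻¹' {y}, ∀ x ∈ closure A, ∃ B ⊆ A, B.Countable ∧ x ∈ closure B)
    (A : Set X) (x : X) (hx : x ∈ closure A) : ∃ B ⊆ A, B.Countable ∧ x ∈ closure B := by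
  let OC : Set X → Prop := fun D => ∀ C ⊆ D, C.Countable → closure C ⊆ D
  have himage : ∀ D, OC D → IsClosed (f '' D) := by
    intro D hD
    refine isClosed_of_closure_subset fun y hy => ?_
    obtain ⟨E, hED, hE, hyE⟩ := hY _ y hy
    obtain ⟨C, hCD, hC, rfl⟩ : ∃ C ⊆ D, C.Countable ∧ f '' C = E := by
      have : Nonempty X := ⟨x⟩
      choose! g hg using hED
      refine ⟨g '' E, ?_, hE.image _, ?_⟩
      · rintro _ ⟨e, he, rfl⟩
        exact (hg he).1
      · rw [image_image]
        exact (image_congr fun e he => (hg he).2).trans (image_id' E)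
    have h1 : closure (f '' C) ⊆ f '' closure C :=
      closure_minimal (image_mono subset_closure) (isClosed_closure.isCompact.image hf).isClosed
    exact image_mono (hD C hCD hC) (h1 hyE)
  let D : Set X := {p | ∃ B ⊆ A, B.Countable ∧ p ∈ closure B}
  have hD : OC D := by
    intro C hCD hC p hp
    have hCD' : ∀ c ∈ C, ∃ B : Set X, B ⊆ A ∧ B.Countable ∧ c ∈ closure B := fun c hc => hCD hc
    choose! B hBA hB hpB using hCD'
    refine ⟨⋃ c ∈ C, B c, iUnion₂_subset fun c hc => hBA c hc, hC.biUnion fun c hc => hB c hc, ?_⟩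
    refine closure_minimal (fun c hc => ?_) isClosed_closure hp
    exact closure_mono (subset_biUnion_of_mem (u := B) hc) (hpB c hc)
  have hAD : A ⊆ D := fun a ha => ⟨{a}, singleton_subset_iff.2 ha, countable_singleton a,
    subset_closure rfl⟩
  by_contra hxD
  have hF : IsClosed (D ∩ f ⁻¹' {f x}) := by
    refine isClosed_of_closure_subset fun p hp => ?_
    have hp1 : p ∈ f ⁻¹' {f x} :=
      closure_minimal inter_subset_right (isClosed_singleton.preimage hf) hp
    obtain ⟨B, hB, hBc, hpB⟩ := hfib (f x) _ inter_subset_right p hp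
    exact ⟨hD B (hB.trans inter_subset_left) hBc hpB, hp1⟩
  obtain ⟨V, hV, hVc, hVF⟩ := exists_mem_nhds_isClosed_subset
    (hF.isOpen_compl.mem_nhds (x := x) fun h => hxD h.1)
  have hDV : OC (D ∩ V) := fun C hC hCc => subset_inter
    (hD C (hC.trans inter_subset_left) hCc) (closure_minimal (hC.trans inter_subset_right) hVc)
  have hxDV : x ∈ closure (D ∩ V) := by
    rw [mem_closure_iff_nhds]
    intro t ht
    obtain ⟨a, ⟨hat, haV⟩, haA⟩ := mem_closure_iff_nhds.1 hx (t ∩ V) (Filter.inter_mem ht hV)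
    exact ⟨a, hat, hAD haA, haV⟩
  obtain ⟨a, ⟨haD, haV⟩, hax⟩ := (himage _ hDV).closure_subset
    (image_closure_subset_closure_image hf ⟨x, hxDV, rfl⟩)
  exact hVF haV ⟨haD, hax⟩

/-- Finite powers of a countably tight compact Hausdorff space are countably tight. -/
theorem exists_countable_mem_closure_pi_fin {K : Type*} [TopologicalSpace K] [CompactSpace K]
    [T2Space K]
    (htight : ∀ A : Set K, ∀ x ∈ closure A, ∃ B ⊆ A, B.Countable ∧ x ∈ closure B) (m : ℕ) :
    ∀ A : Set (Fin m → K), ∀ x ∈ closure A, ∃ B ⊆ A, B.Countable ∧ x ∈ closure B := by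
  induction m with
  | zero => exact fun A x hx => ⟨A, Subset.rfl, (Set.toFinite A).countable, hx⟩
  | succ m ih =>
    refine exists_countable_mem_closure_of_fibers (fun x => x 0) (continuous_apply 0) htight ?_
    intro y A hA x hx
    have hx0 : x 0 = y :=
      closure_minimal hA (isClosed_singleton.preimage (continuous_apply 0)) hx
    have htail : Continuous (Fin.tail : (Fin (m + 1) → K) → Fin m → K) :=
      continuous_pi fun i => continuous_apply _
    have hcons : Continuous fun z : Fin m → K => (Fin.cons y z : Fin (m + 1) → K) :=
      continuous_pi fun i => by
        refine Fin.cases ?_ (fun j => ?_) i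
        · simpa using continuous_const
        · simpa using continuous_apply j
    obtain ⟨B, hBA, hB, hxB⟩ := ih (Fin.tail '' A) (Fin.tail x)
      (image_closure_subset_closure_image htail ⟨x, hx, rfl⟩)
    refine ⟨_, ?_, hB.image fun z => (Fin.cons y z : Fin (m + 1) → K),
      image_closure_subset_closure_image hcons ⟨_, hxB, ?_⟩⟩
    · rintro _ ⟨z, hz, rfl⟩
      obtain ⟨a, ha, rfl⟩ := hBA hz
      rw [← show a 0 = y from hA ha]
      simpa [Fin.cons_self_tail] using ha
    · rw [← hx0]
      exact Fin.cons_self_tail x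

/-- A countably tight compact space carries no uncountable family of points biorthogonal, up to a
uniform error, to a family of continuous functions. -/
theorem false_of_uncountable_separated {L Ω : Type*} [TopologicalSpace L] [CompactSpace L]
    (htight : ∀ A : Set L, ∀ x ∈ closure A, ∃ B ⊆ A, B.Countable ∧ x ∈ closure B)
    [LinearOrder Ω] (hΩ : ∀ a : Ω, (Iic a).Countable) (S : Set Ω) (hS : ¬ S.Countable)
    (x : Ω → L) (g : Ω → L → ℝ) (hg : ∀ η ∈ S, Continuous (g η))
    (h1 : ∀ ξ ∈ S, ∀ η ∈ S, η < ξ → 3 / 4 ≤ g η (x ξ))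
    (h0 : ∀ ξ ∈ S, ∀ η ∈ S, ξ ≤ η → g η (x ξ) ≤ 1 / 4) : False := by
  have habove : ∀ B : Set Ω, B.Countable → ∃ η ∈ S, ∀ ξ ∈ B, ξ < η := by
    intro B hB
    by_contra! hcon
    refine hS ((hB.biUnion fun b _ => hΩ b).mono fun η hη => ?_)
    obtain ⟨ξ, hξ, hle⟩ := hcon η hη
    exact mem_biUnion hξ hle
  have hSne : Nonempty S := by
    obtain ⟨η, hη, -⟩ := habove ∅ countable_empty
    exact ⟨η, hη⟩
  let T : S → Set L := fun η => closure (x '' (S ∩ Ioi η.1))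
  obtain ⟨p, hp⟩ : (⋂ η, T η).Nonempty := by
    refine IsCompact.nonempty_iInter_of_directed_nonempty_isCompact_isClosed T ?_ ?_
      (fun η => isClosed_closure.isCompact) fun η => isClosed_closure
    · intro a b
      refine ⟨max a b, closure_mono (image_mono ?_), closure_mono (image_mono ?_)⟩
      · exact inter_subset_inter_right _ (Ioi_subset_Ioi (le_max_left a b))
      · exact inter_subset_inter_right _ (Ioi_subset_Ioi (le_max_right a b))
    · intro η
      obtain ⟨ξ, hξ, hlt⟩ := habove {η.1} (countable_singleton _)
      exact ⟨x ξ, subset_closure ⟨ξ, ⟨hξ, hlt _ rfl⟩, rfl⟩⟩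
  rw [mem_iInter] at hp
  have hpS : p ∈ closure (x '' S) :=
    closure_mono (image_mono inter_subset_left) (hp hSne.some)
  obtain ⟨B, hBS, hB, hpB⟩ := htight _ p hpS
  have hΩne : Nonempty Ω := ⟨hSne.some.1⟩
  have hBS' : ∀ b ∈ B, ∃ c : Ω, c ∈ S ∧ x c = b := fun b hb => hBS hb
  choose! c hcS hcx using hBS'
  obtain ⟨η, hη, hlt⟩ := habove (c '' B) (hB.image c)
  have h2 : g η p ≤ 1 / 4 := by
    refine closure_minimal (fun b hb => ?_) (isClosed_le (hg η hη) continuous_const) hpB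
    have := h0 (c b) (hcS b hb) η hη (hlt _ ⟨b, hb, rfl⟩).le
    rwa [hcx b hb] at this
  have h3 : 3 / 4 ≤ g η p := by
    refine closure_minimal ?_ (isClosed_le continuous_const (hg η hη)) (hp ⟨η, hη⟩)
    rintro _ ⟨ξ, ⟨hξ, hlt⟩, rfl⟩
    exact h1 ξ hξ η hη hlt
  linarith

theorem Submodule.exists_norm_sub_lt_of_mem_topologicalClosure {E : Type*} [NormedAddCommGroup E]
    [NormedSpace ℝ E] {W : Submodule ℝ E} {v : E} (hv : v ∈ W.topologicalClosure) {ε : ℝ}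
    (hε : 0 < ε) : ∃ w ∈ W, ‖v - w‖ < ε := by
  obtain ⟨w, hw, hd⟩ := Metric.mem_closure_iff.1 hv ε hε
  exact ⟨w, hw, by rwa [← dist_eq_norm]⟩

/-- On a scattered compact Hausdorff space, every functional on `C(K)` is a norm limit of finite
rational combinations of point evaluations. -/
theorem exists_rat_combination_approx {K : Type*} [TopologicalSpace K] [CompactSpace K] [T2Space K]
    (hscat : ∀ S : Set K, S.Nonempty → IsClosed S →
      ∃ x ∈ S, ∃ U : Set K, IsOpen U ∧ U ∩ S = {x})
    (ψ : C(K, ℝ) →L[ℝ] ℝ) {ε : ℝ} (hε : 0 < ε) :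
    ∃ (c : Σ m : ℕ, Fin m → ℚ) (x : Fin c.1 → K),
      ∀ f : C(K, ℝ), |ψ f - ∑ i, (c.2 i : ℝ) * f (x i)| ≤ ε * ‖f‖ := by
  have hψ : ψ ∈ (Submodule.span ℝ (range fun x : K => (ContinuousMap.evalCLM ℝ x :
      C(K, ℝ) →L[ℝ] ℝ))).topologicalClosure := by
    rw [topologicalClosure_span_range_evalCLM_eq_top hscat]
    exact Submodule.mem_top
  obtain ⟨w, hw, hd⟩ := Submodule.exists_norm_sub_lt_of_mem_topologicalClosure
    (E := C(K, ℝ) →L[ℝ] ℝ) hψ (half_pos hε)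
  obtain ⟨m, a, z, rfl⟩ := Submodule.mem_span_set'.1 hw
  choose x hx using fun i => (z i).2
  have hδ : 0 < ε / 2 / (m + 1) := by positivity
  choose q hq using fun i => exists_rat_near (a i) hδ
  refine ⟨⟨m, q⟩, x, fun f => ?_⟩
  have h1 : |ψ f - ∑ i, a i * f (x i)| ≤ ε / 2 * ‖f‖ := by
    have h2 := (ψ - ∑ i, a i • (z i : C(K, ℝ) →L[ℝ] ℝ)).le_of_opNorm_le
      hd.le f
    simpa [_root_.sum_apply, ← hx] using h2
  have h3 : |∑ i, a i * f (x i) - ∑ i, (q i : ℝ) * f (x i)| ≤ ε / 2 * ‖f‖ := by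
    rw [← Finset.sum_sub_distrib]
    refine (Finset.abs_sum_le_sum_abs _ _).trans ?_
    have h4 : ∀ i ∈ Finset.univ, |a i * f (x i) - (q i : ℝ) * f (x i)| ≤
        ε / 2 / (m + 1) * ‖f‖ := fun i _ => by
      rw [← sub_mul, abs_mul]
      exact mul_le_mul (hq i).le (f.norm_coe_le_norm _) (abs_nonneg _) hδ.le
    refine (Finset.sum_le_card_nsmul _ _ _ h4).trans ?_
    rw [Finset.card_univ, Fintype.card_fin, nsmul_eq_mul, ← mul_assoc]
    refine mul_le_mul_of_nonneg_right ?_ (norm_nonneg _)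
    rw [mul_div_assoc', div_le_iff₀ (by positivity)]
    nlinarith
  have h5 := abs_sub_le (ψ f) (∑ i, a i * f (x i)) (∑ i, (q i : ℝ) * f (x i))
  linarith

theorem exists_not_countable_inter_preimage_singleton {α ι : Type*} [Countable ι] {S : Set α}
    (hS : ¬ S.Countable) (g : α → ι) : ∃ c, ¬ (S ∩ g ⁻¹' {c}).Countable := by
  by_contra! h
  refine hS ((countable_iUnion h).mono fun a ha => mem_iUnion.2 ⟨g a, ?_⟩)
  exact ⟨ha, rfl⟩

/-- On a scattered, countably tight compact Hausdorff space there is no uncountable long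
triangular system of uniformly bounded functionals and functions. -/
theorem false_of_uncountable_triangular {K Ω : Type*} [TopologicalSpace K] [CompactSpace K]
    [T2Space K]
    (hscat : ∀ S : Set K, S.Nonempty → IsClosed S →
      ∃ x ∈ S, ∃ U : Set K, IsOpen U ∧ U ∩ S = {x})
    (htight : ∀ A : Set K, ∀ x ∈ closure A, ∃ B ⊆ A, B.Countable ∧ x ∈ closure B)
    [LinearOrder Ω] (hΩ : ∀ a : Ω, (Iic a).Countable) (hΩ' : ¬ (Set.univ : Set Ω).Countable)
    (y : Ω → C(K, ℝ) →L[ℝ] ℝ) (f : Ω → C(K, ℝ))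
    (h1 : ∀ ξ η, η < ξ → y ξ (f η) = 1) (h0 : ∀ ξ η, ξ ≤ η → y ξ (f η) = 0) : False := by
  choose N hN using fun ξ => exists_nat_ge ‖f ξ‖
  obtain ⟨M, hM⟩ := exists_not_countable_inter_preimage_singleton hΩ' N
  have hε : 0 < 1 / (4 * ((M : ℝ) + 1)) := by positivity
  choose c hc using fun ξ => exists_rat_combination_approx hscat (y ξ) hε
  obtain ⟨⟨m, q⟩, hq⟩ := exists_not_countable_inter_preimage_singleton hM c
  have hx : ∀ ξ ∈ (Set.univ ∩ N ⁻¹' {M}) ∩ c ⁻¹' {⟨m, q⟩}, ∃ x : Fin m → K,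
      ∀ f : C(K, ℝ), |y ξ f - ∑ i, (q i : ℝ) * f (x i)| ≤ 1 / (4 * ((M : ℝ) + 1)) * ‖f‖ := by
    rintro ξ ⟨-, hξ⟩
    have h2 := hc ξ
    rw [show c ξ = ⟨m, q⟩ from hξ] at h2
    exact h2
  have hne : Nonempty (Fin m → K) := by
    have hS : ((Set.univ ∩ N ⁻¹' {M}) ∩ c ⁻¹' {⟨m, q⟩}).Nonempty := by
      rw [Set.nonempty_iff_ne_empty]
      intro h
      exact hq (by rw [h]; exact countable_empty)
    obtain ⟨ξ, hξ⟩ := hS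
    exact ⟨(hx ξ hξ).choose⟩
  choose! x hx using hx
  have hle : ∀ ξ ∈ (Set.univ ∩ N ⁻¹' {M}) ∩ c ⁻¹' {⟨m, q⟩},
      ∀ η ∈ (Set.univ ∩ N ⁻¹' {M}) ∩ c ⁻¹' {⟨m, q⟩},
      |y ξ (f η) - ∑ i, (q i : ℝ) * f η (x ξ i)| ≤ 1 / 4 := by
    intro ξ hξ η hη
    refine (hx ξ hξ (f η)).trans ?_
    have h2 : ‖f η‖ ≤ M := by
      rw [← show N η = M from hη.1.2]
      exact hN η
    rw [div_mul_eq_mul_div, one_mul, div_le_div_iff₀ (by positivity) (by positivity)]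
    linarith
  refine false_of_uncountable_separated (exists_countable_mem_closure_pi_fin htight m) hΩ _ hq x
    (fun η z => ∑ i, (q i : ℝ) * f η (z i)) (fun η _ => by fun_prop) ?_ ?_
  · intro ξ hξ η hη hlt
    have := abs_le.1 (hle ξ hξ η hη)
    rw [h1 ξ η hlt] at this
    linarith [this.2]
  · intro ξ hξ η hη hle'
    have := abs_le.1 (hle ξ hξ η hη)
    rw [h0 ξ η hle'] at this
    linarith [this.1]

/-- Transfinite recursion of length `ω₁` along a relation that every countable set of previous
values allows to continue. -/
theorem exists_uncountable_recursion {P : Type*} (Q : Set P → P → Prop)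
    (hQ : ∀ H : Set P, H.Countable → ∃ p, Q H p) :
    ∃ (Ω : Type) (_ : LinearOrder Ω) (s : Ω → P), (∀ a : Ω, (Iic a).Countable) ∧
      ¬ (Set.univ : Set Ω).Countable ∧ ∀ ξ, Q (s '' Iio ξ) (s ξ) := by
  let Ω := (ℵ₁ : Cardinal.{0}).ord.ToType
  have hIio : ∀ a : Ω, (Iio a).Countable := fun a => by
    rw [← le_aleph0_iff_set_countable, ← lt_aleph_one_iff]
    simpa [Ω] using mk_Iio_lt a (by simp [Ω])
  obtain ⟨p₀, -⟩ := hQ ∅ countable_empty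
  have : Nonempty P := ⟨p₀⟩
  choose! g hg using hQ
  let step : (ξ : Ω) → ((η : Ω) → η < ξ → P) → P := fun ξ ih => g {p | ∃ η, ∃ h : η < ξ, ih η h = p}
  let s : Ω → P := (wellFounded_lt (α := Ω)).fix step
  have hs : ∀ ξ, s ξ = g (s '' Iio ξ) := fun ξ => by
    have h1 : s ξ = g {p | ∃ η, ∃ _ : η < ξ, s η = p} := WellFounded.fix_eq _ step ξ
    rw [h1]
    congr 1
    ext p
    simp
  refine ⟨Ω, inferInstance, s, fun a => ?_, ?_, fun ξ => ?_⟩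
  · rw [← Iio_insert]
    exact (hIio a).insert a
  · rw [← le_aleph0_iff_set_countable, ← lt_aleph_one_iff, mk_univ]
    simp [Ω]
  · rw [hs ξ]
    exact hg _ ((hIio ξ).image s)

/-- The functionals determined by countably many members of `F`: those vanishing wherever some
countable subset of `F` vanishes. -/
def countablyDetermined {X : Type*} [NormedAddCommGroup X] [NormedSpace ℝ X]
    (F : Set (X →L[ℝ] ℝ)) : Submodule ℝ (X →L[ℝ] ℝ) where
  carrier := {φ | ∃ F₀ ⊆ F, F₀.Countable ∧ ∀ f, (∀ ψ ∈ F₀, ψ f = 0) → φ f = 0}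
  zero_mem' := ⟨∅, empty_subset _, countable_empty, fun _ _ => rfl⟩
  add_mem' := by
    rintro φ φ' ⟨A, hAF, hA, hφ⟩ ⟨B, hBF, hB, hφ'⟩
    refine ⟨A ∪ B, union_subset hAF hBF, hA.union hB, fun f hf => ?_⟩
    rw [add_apply, hφ f fun ψ h => hf ψ (Or.inl h),
      hφ' f fun ψ h => hf ψ (Or.inr h), add_zero]
  smul_mem' := by
    rintro c φ ⟨A, hAF, hA, hφ⟩
    exact ⟨A, hAF, hA, fun f hf => by rw [smul_apply, hφ f hf, smul_zero]⟩

theorem WeakDual.norm_le_of_mem_closure {X : Type*} [NormedAddCommGroup X] [NormedSpace ℝ X]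
    {S : Set (WeakDual ℝ X)} {r : ℝ} (hS : ∀ w ∈ S, ‖WeakDual.toStrongDual w‖ ≤ r)
    {φ : WeakDual ℝ X} (hφ : φ ∈ closure S) : ‖WeakDual.toStrongDual φ‖ ≤ r := by
  have hsub : S ⊆ WeakDual.toStrongDual ⁻¹' Metric.closedBall 0 r :=
    fun w hw => mem_preimage.2 (mem_closedBall_zero_iff.2 (hS w hw))
  exact mem_closedBall_zero_iff.1 (closure_minimal hsub (WeakDual.isClosed_closedBall 0 r) hφ)

section CountablyDetermined

variable {X : Type*} [NormedAddCommGroup X] [NormedSpace ℝ X] {F : Set (X →L[ℝ] ℝ)}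

theorem subset_countablyDetermined : F ⊆ countablyDetermined F := fun φ hφ =>
  ⟨{φ}, singleton_subset_iff.2 hφ, countable_singleton φ, fun _ hf => hf φ rfl⟩

theorem exists_countable_of_subset_countablyDetermined {A : Set (X →L[ℝ] ℝ)} (hA : A.Countable)
    (hAF : A ⊆ countablyDetermined F) :
    ∃ F₀ ⊆ F, F₀.Countable ∧ ∀ f, (∀ ψ ∈ F₀, ψ f = 0) → ∀ φ ∈ A, φ f = 0 := by
  have h : ∀ φ ∈ A, ∃ F₀ : Set (X →L[ℝ] ℝ), F₀ ⊆ F ∧ F₀.Countable ∧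
    ∀ f, (∀ ψ ∈ F₀, ψ f = 0) → φ f = 0 := fun φ hφ => hAF hφ
  choose! G hGF hG hGφ using h
  exact ⟨⋃ φ ∈ A, G φ, iUnion₂_subset hGF, hA.biUnion hG, fun f hf φ hφ =>
    hGφ φ hφ f fun ψ hψ => hf ψ (mem_biUnion hφ hψ)⟩

/-- A functional outside `countablyDetermined F` is normalized by a vector that any prescribed
countable part of `countablyDetermined F` annihilates. -/
theorem exists_apply_eq_one_of_notMem_countablyDetermined {A : Set (X →L[ℝ] ℝ)}
    (hA : A.Countable) (hAF : A ⊆ countablyDetermined F) {φ : X →L[ℝ] ℝ}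
    (hφ : φ ∉ countablyDetermined F) : ∃ f, φ f = 1 ∧ ∀ ψ ∈ A, ψ f = 0 := by
  obtain ⟨F₀, hF₀, hF₀c, h⟩ := exists_countable_of_subset_countablyDetermined hA hAF
  have h1 : ¬ ∀ f, (∀ ψ ∈ F₀, ψ f = 0) → φ f = 0 := fun h1 => hφ ⟨F₀, hF₀, hF₀c, h1⟩
  push Not at h1
  obtain ⟨f, hf, hne⟩ := h1
  refine ⟨(φ f)⁻¹ • f, ?_, fun ψ hψ => ?_⟩
  · rw [map_smul, smul_eq_mul, inv_mul_cancel₀ hne]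
  · rw [map_smul, h f hf ψ hψ, smul_zero]

open Topology Filter in
/-- Countably many values of a functional in the weak-* closure of a ball of
`countablyDetermined F` are attained within that ball. -/
theorem exists_mem_countablyDetermined_eqOn {r : ℝ} {φ : WeakDual ℝ X}
    (hφ : φ ∈ closure {w : WeakDual ℝ X | WeakDual.toStrongDual w ∈ countablyDetermined F ∧
      ‖WeakDual.toStrongDual w‖ ≤ r}) {G : Set X} (hG : G.Countable) :
    ∃ y ∈ countablyDetermined F, ‖y‖ ≤ r ∧ ∀ f ∈ G, y f = φ f := by
  obtain ⟨e, he⟩ := (hG.insert 0).exists_eq_range (insert_nonempty _ _)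
  have happrox : ∀ n : ℕ, ∃ w : WeakDual ℝ X, (WeakDual.toStrongDual w ∈ countablyDetermined F ∧
      ‖WeakDual.toStrongDual w‖ ≤ r) ∧ ∀ i ≤ n, |w (e i) - φ (e i)| < 1 / ((n : ℝ) + 1) := by
    intro n
    have hU : {w : WeakDual ℝ X | ∀ i ∈ Finset.Iic n, |w (e i) - φ (e i)| < 1 / ((n : ℝ) + 1)} ∈
        𝓝 φ := by
      refine (Filter.eventually_all_finset (Finset.Iic n)).2 fun i _ => ?_
      refine (isOpen_lt ((WeakDual.eval_continuous (e i)).sub continuous_const).abs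
        continuous_const).mem_nhds ?_
      change |φ (e i) - φ (e i)| < 1 / ((n : ℝ) + 1)
      rw [sub_self, abs_zero]
      positivity
    obtain ⟨w, hwU, hw⟩ := mem_closure_iff_nhds.1 hφ _ hU
    exact ⟨w, hw, fun i hi => hwU i (Finset.mem_Iic.2 hi)⟩
  choose w hw hwe using happrox
  obtain ⟨F₀, hF₀, hF₀c, h⟩ := exists_countable_of_subset_countablyDetermined (F := F)
    (countable_range fun n => WeakDual.toStrongDual (w n))
    (by rintro _ ⟨n, rfl⟩; exact (hw n).1)
  obtain ⟨y, hyr, hy⟩ := (WeakDual.isCompact_closedBall (𝕜 := ℝ) (E := X) 0 r).ultrafilter_le_nhds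
    ((hyperfilter ℕ).map w) (by
      rw [le_principal_iff]
      exact mem_map.2 (Eventually.of_forall fun n => mem_closedBall_zero_iff.2 (hw n).2))
  have hlim : ∀ f, Tendsto (fun n => w n f) (hyperfilter ℕ) (𝓝 (y f)) := fun f =>
    ((WeakDual.eval_continuous f).tendsto y).comp hy
  refine ⟨WeakDual.toStrongDual y, ⟨F₀, hF₀, hF₀c, fun f hf => ?_⟩,
    mem_closedBall_zero_iff.1 hyr, fun f hf => ?_⟩
  · refine tendsto_nhds_unique (hlim f) ?_
    simp_rw [show ∀ n, w n f = 0 from fun n => h f hf _ ⟨n, rfl⟩]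
    exact tendsto_const_nhds
  · obtain ⟨i, rfl⟩ : f ∈ range e := he ▸ mem_insert_of_mem _ hf
    refine tendsto_nhds_unique (hlim (e i)) (Tendsto.mono_left ?_ Nat.hyperfilter_le_atTop)
    rw [tendsto_iff_norm_sub_tendsto_zero]
    refine squeeze_zero' (Eventually.of_forall fun n => norm_nonneg _)
      (eventually_atTop.2 ⟨i, fun n hn => (hwe n i hn).le⟩) tendsto_one_div_add_atTop_nhds_zero_nat

end CountablyDetermined

/-- On a scattered, countably tight compact Hausdorff space, `countablyDetermined F` meets closed
balls of the dual of `C(K)` in weak-* closed sets. -/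
theorem isClosed_countablyDetermined_inter_closedBall {K : Type*} [TopologicalSpace K]
    [CompactSpace K] [T2Space K]
    (hscat : ∀ S : Set K, S.Nonempty → IsClosed S →
      ∃ x ∈ S, ∃ U : Set K, IsOpen U ∧ U ∩ S = {x})
    (htight : ∀ A : Set K, ∀ x ∈ closure A, ∃ B ⊆ A, B.Countable ∧ x ∈ closure B)
    (F : Set (C(K, ℝ) →L[ℝ] ℝ)) (r : ℝ) :
    IsClosed {w : WeakDual ℝ C(K, ℝ) | WeakDual.toStrongDual w ∈ countablyDetermined F ∧
      ‖WeakDual.toStrongDual w‖ ≤ r} := by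
  refine isClosed_of_closure_subset fun φ hφ => ?_
  refine ⟨?_, WeakDual.norm_le_of_mem_closure (fun w hw => hw.2) hφ⟩
  by_contra hmem
  let P := {p : (C(K, ℝ) →L[ℝ] ℝ) × C(K, ℝ) // p.1 ∈ countablyDetermined F ∧ φ p.2 = 1}
  obtain ⟨Ω, _, s, hΩ, hΩ', hs⟩ := exists_uncountable_recursion
    (fun (H : Set P) (p : P) => (∀ q ∈ H, p.1.1 q.1.2 = 1) ∧ p.1.1 p.1.2 = 0 ∧
      ∀ q ∈ H, q.1.1 p.1.2 = 0) (by
    intro H hH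
    obtain ⟨y, hy, -, hyH⟩ := exists_mem_countablyDetermined_eqOn hφ (hH.image fun q => q.1.2)
    obtain ⟨f, hf1, hf0⟩ := exists_apply_eq_one_of_notMem_countablyDetermined
      ((hH.image fun q => q.1.1).insert y) (by
        refine insert_subset hy ?_
        rintro _ ⟨q, -, rfl⟩
        exact q.2.1) hmem
    refine ⟨⟨(y, f), hy, hf1⟩, fun q hq => ?_, hf0 y (mem_insert _ _), fun q hq => ?_⟩
    · exact (hyH _ ⟨q, hq, rfl⟩).trans q.2.2
    · exact hf0 _ (mem_insert_of_mem _ ⟨q, hq, rfl⟩))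
  refine false_of_uncountable_triangular hscat htight hΩ hΩ' (fun ξ => (s ξ).1.1)
    (fun ξ => (s ξ).1.2) (fun ξ η hlt => (hs ξ).1 _ ⟨η, hlt, rfl⟩) fun ξ η hle => ?_
  rcases hle.eq_or_lt with rfl | hlt
  · exact (hs ξ).2.1
  · exact (hs η).2.2 _ ⟨ξ, hlt, rfl⟩

/-- If `C(K)` has CSP then `K` is separable. -/
theorem separableSpace_of_hasCSP {K : Type*} [TopologicalSpace K] [CompactSpace K] [T2Space K]
    (h : HasCSP C(K, ℝ)) : TopologicalSpace.SeparableSpace K := by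
  obtain ⟨F₀, hF₀, hF₀c, hsep⟩ := h (range fun x : K => ContinuousMap.evalCLM ℝ x) (by
    intro f hf
    obtain ⟨x, hx⟩ := DFunLike.ne_iff.1 hf
    exact ⟨_, ⟨x, rfl⟩, hx⟩)
  have hF₀' : ∀ φ ∈ F₀, ∃ x : K, ContinuousMap.evalCLM ℝ x = φ := fun φ hφ => hF₀ hφ
  rcases isEmpty_or_nonempty K with hK | hK
  · infer_instance
  choose! p hp using hF₀'
  refine ⟨⟨p '' F₀, hF₀c.image p, fun x => ?_⟩⟩
  by_contra hx
  obtain ⟨f, hf0, hf1, -⟩ := exists_continuous_zero_one_of_isClosed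
    (isClosed_closure (s := p '' F₀)) (isClosed_singleton (x := x))
    (disjoint_singleton_right.2 hx)
  obtain ⟨φ, hφ, hne⟩ := hsep f fun h0 => by simpa [h0] using hf1 (mem_singleton x)
  refine hne ?_
  rw [← hp φ hφ]
  exact hf0 (subset_closure ⟨φ, hφ, rfl⟩)

/-- For a scattered, countably tight compact Hausdorff space `K`, the space `C(K)` has CSP
iff `K` is separable. -/
theorem hasCSP_CK_iff_separable (K : Type*) [TopologicalSpace K] [CompactSpace K]
    [T2Space K]
    (hscat : ∀ S : Set K, S.Nonempty → IsClosed S →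
      ∃ x ∈ S, ∃ U : Set K, IsOpen U ∧ U ∩ S = {x})
    (htight : ∀ A : Set K, ∀ x ∈ closure A, ∃ B ⊆ A, B.Countable ∧ x ∈ closure B) :
    HasCSP (ContinuousMap K ℝ) ↔ TopologicalSpace.SeparableSpace K := by
  refine ⟨separableSpace_of_hasCSP, fun hsepK F hF => ?_⟩
  have htop : countablyDetermined F = ⊤ :=
    Submodule.eq_top_of_isClosed_weakDual_inter_closedBall _
      (isClosed_countablyDetermined_inter_closedBall hscat htight F) fun f hf => by
        by_contra hne
        obtain ⟨φ, hφ, h⟩ := hF f hne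
        exact h (hf φ (subset_countablyDetermined hφ))
  obtain ⟨D, hDc, hD⟩ := TopologicalSpace.exists_countable_dense K
  obtain ⟨F₀, hF₀, hF₀c, h⟩ := exists_countable_of_subset_countablyDetermined (F := F)
    (hDc.image fun x => ContinuousMap.evalCLM ℝ x) (by rw [htop]; exact subset_univ _)
  refine ⟨F₀, hF₀, hF₀c, fun f hf => ?_⟩
  by_contra! hcon
  refine hf (ContinuousMap.ext fun x => ?_)
  exact congrFun (f.continuous.ext_on hD continuous_const
    fun d hd => h f hcon _ ⟨d, hd, rfl⟩) x
end

section
/- Let X be a Banach space over ℝ whose dual X* satisfies: for every set A ⊆ X* and every f in the weak-star closure of A, there is a countable subset A₀ ⊆ A such that f belongs to the weak-star closure of the linear span of A₀. Let κ be an uncountable regular cardinal and {Y_σ}_{σ<κ} a family of nonempty closed affine subspaces of X (translates of closed linear subspaces) with Y_β ⊆ Y_α whenever α < β < κ and ⋂_{σ<κ} Y_σ = {y}. If y_σ ∈ Y_σ for each σ < κ, then for every continuous linear functional f on X there exists σ₀ < κ such that f(y_σ) = f(y) for all σ with σ₀ ≤ σ < κ; in particular y_σ → y weakly as σ → κ.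 -/
open Set Cardinal Pointwise

/-- A closed subspace of a locally convex space is separated from every point outside it by a
continuous linear functional vanishing on the subspace. -/
theorem Submodule.exists_strongDual_eq_zero_ne_zero_of_notMem {E : Type*} [AddCommGroup E]
    [Module ℝ E] [TopologicalSpace E] [IsTopologicalAddGroup E] [ContinuousSMul ℝ E]
    [LocallyConvexSpace ℝ E] (p : Submodule ℝ E) (hp : IsClosed (p : Set E)) {x : E}
    (hx : x ∉ p) : ∃ f : StrongDual ℝ E, (∀ a ∈ p, f a = 0) ∧ f x ≠ 0 := by
  obtain ⟨f, u, hu, hux⟩ := geometric_hahn_banach_closed_point p.convex hp hx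
  have hu0 : 0 < u := by simpa using hu 0 p.zero_mem
  refine ⟨f, fun a ha => ?_, (hu0.trans hux).ne'⟩
  by_contra hne
  have h := hu ((u / f a) • a) (p.smul_mem _ ha)
  rw [map_smul, smul_eq_mul, div_mul_cancel₀ _ hne] at h
  exact h.false

/-- A subspace of the dual that separates the points of `X` is weak-star dense. -/
theorem WeakDual.dense_of_separating {X : Type*} [AddCommGroup X] [Module ℝ X]
    [TopologicalSpace X] (p : Submodule ℝ (WeakDual ℝ X))
    (hp : ∀ x : X, (∀ g ∈ p, g x = 0) → x = 0) : Dense (p : Set (WeakDual ℝ X)) := by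
  have : LocallyConvexSpace ℝ (WeakDual ℝ X) :=
    WeakBilin.locallyConvexSpace (B := topDualPairing ℝ X)
  intro f
  by_contra hf
  obtain ⟨φ, hφ, hφf⟩ := p.topologicalClosure.exists_strongDual_eq_zero_ne_zero_of_notMem
    p.isClosed_topologicalClosure hf
  obtain ⟨x, hx⟩ := LinearMap.dualEmbedding_surjective (B := topDualPairing ℝ X) φ
  have hev : ∀ g : WeakDual ℝ X, φ g = g x := fun g => by rw [← hx]; rfl
  have hx0 : x = 0 := hp x fun g hg => by
    rw [← hev]; exact hφ g (p.le_topologicalClosure hg)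
  exact hφf (by rw [hev, hx0, map_zero])

/-- A countable family of elements below the initial ordinal of an uncountable regular cardinal is
bounded. -/
theorem Cardinal.IsRegular.exists_forall_le_of_countable {κ : Cardinal} (hκ : ℵ₀ < κ)
    (hreg : κ.IsRegular) {ι : Type*} [Countable ι] (s : ι → {σ : Ordinal // σ < κ.ord}) :
    ∃ σ₀, ∀ i, s i ≤ σ₀ := by
  have hlt : ⨆ i, (s i : Ordinal) < κ.ord := by
    refine Ordinal.lift_iSup_lt_of_lt_cof ?_ fun i => (s i).2
    rw [← Ordinal.lift_cof, hreg.cof_ord]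
    exact (lift_le_aleph0.2 mk_le_aleph0).trans_lt (aleph0_lt_lift.2 hκ)
  exact ⟨⟨_, hlt⟩, fun i => le_ciSup (f := fun i => (s i : Ordinal))
    ⟨κ.ord, by rintro _ ⟨j, rfl⟩; exact (s j).2.le⟩ i⟩

/-- The functionals that are constant on some member of an antitone family of sets containing `y`
form a subspace of the dual. -/
def WeakDual.eventuallyConst {X : Type*} [AddCommGroup X] [Module ℝ X] [TopologicalSpace X]
    {ι : Type*} [LinearOrder ι] [Nonempty ι] (Y : ι → Set X) (hY : Antitone Y) (y : X) :
    Submodule ℝ (WeakDual ℝ X) where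
  carrier := {g | ∃ i, ∀ x ∈ Y i, g x = g y}
  zero_mem' := ⟨Classical.arbitrary ι, fun _ _ => rfl⟩
  add_mem' := by
    rintro a b ⟨i, hi⟩ ⟨j, hj⟩
    exact ⟨max i j, fun x hx => congrArg₂ (· + ·) (hi x (hY (le_max_left i j) hx))
      (hj x (hY (le_max_right i j) hx))⟩
  smul_mem' := by
    rintro c a ⟨i, hi⟩
    exact ⟨i, fun x hx => congrArg (c • ·) (hi x hx)⟩

/-- If the dual of `X` has the countable-span tightness property and `{Y_σ}` is a nested
long family of closed affine subspaces with intersection `{y}`, then any selection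
`y_σ ∈ Y_σ` converges weakly to `y`. -/
theorem weak_convergence_of_affine_intersection (X : Type*) [NormedAddCommGroup X]
    [NormedSpace ℝ X] [CompleteSpace X]
    (h4 : ∀ A : Set (WeakDual ℝ X), ∀ f ∈ closure A,
      ∃ A₀ ⊆ A, A₀.Countable ∧
        f ∈ closure (Submodule.span ℝ A₀ : Set (WeakDual ℝ X)))
    (κ : Cardinal) (hκ : Cardinal.aleph0 < κ) (hreg : κ.IsRegular)
    (Y : {σ : Ordinal // σ < κ.ord} → Set X)
    (haff : ∀ σ, ∃ (v : X) (Z : Submodule ℝ X), IsClosed (Z : Set X) ∧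
      Y σ = (v + ·) '' (Z : Set X))
    (hnest : ∀ α β, α < β → Y β ⊆ Y α)
    (y : X) (hy : ⋂ σ, Y σ = {y})
    (yf : {σ : Ordinal // σ < κ.ord} → X) (hyf : ∀ σ, yf σ ∈ Y σ) :
    (∀ f : X →L[ℝ] ℝ, ∃ σ₀, ∀ σ, σ₀ ≤ σ → f (yf σ) = f y) ∧
      Filter.Tendsto (fun σ => toWeakSpace ℝ X (yf σ)) Filter.atTop
        (nhds (toWeakSpace ℝ X y)) := by
  have : Nonempty {σ : Ordinal // σ < κ.ord} := ⟨⟨0, hreg.ord_pos⟩⟩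
  have hanti : Antitone Y := fun α β h => h.eq_or_lt.elim (fun h => h ▸ le_rfl) (hnest α β)
  have hyY : ∀ σ, y ∈ Y σ := mem_iInter.1 (hy ▸ mem_singleton y)
  have hdir : ∀ σ, ∃ Z : Submodule ℝ X, IsClosed (Z : Set X) ∧ ∀ x, x ∈ Y σ ↔ x - y ∈ Z := by
    intro σ
    obtain ⟨v, Z, hZ, hYZ⟩ := haff σ
    have hmem : ∀ x, x ∈ Y σ ↔ x - v ∈ Z := fun x => by
      rw [hYZ, image_add_left, mem_preimage, neg_add_eq_sub, SetLike.mem_coe]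
    refine ⟨Z, hZ, fun x => ?_⟩
    rw [hmem, ← Z.sub_mem_iff_left ((hmem y).1 (hyY σ)), sub_sub_sub_cancel_right]
  have hdense := WeakDual.dense_of_separating (WeakDual.eventuallyConst Y hanti y) <| by
    intro x hx
    have hmem : y + x ∈ ⋂ σ, Y σ := mem_iInter.2 fun σ => by
      obtain ⟨Z, hZ, hYZ⟩ := hdir σ
      rw [hYZ, add_sub_cancel_left]
      by_contra hxZ
      obtain ⟨f, hf, hfx⟩ := Z.exists_strongDual_eq_zero_ne_zero_of_notMem hZ hxZ
      refine hfx (hx f.toWeakDual ⟨σ, fun z hz => ?_⟩)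
      exact sub_eq_zero.1 ((map_sub f z y).symm.trans (hf _ ((hYZ z).1 hz)))
    rw [hy] at hmem
    simpa using hmem
  have key : ∀ f : X →L[ℝ] ℝ, ∃ σ₀, ∀ σ, σ₀ ≤ σ → f (yf σ) = f y := by
    intro f
    obtain ⟨A₀, hA₀, hcount, hf⟩ := h4 _ _ (hdense (StrongDual.toWeakDual f))
    choose s hs using fun g : A₀ => hA₀ g.2
    have := hcount.to_subtype
    obtain ⟨σ₀, hσ₀⟩ := hreg.exists_forall_le_of_countable hκ s
    refine ⟨σ₀, fun σ hσ => ?_⟩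
    have hspan : (Submodule.span ℝ A₀ : Set (WeakDual ℝ X)) ⊆ {g | g (yf σ) = g y} := by
      intro g hg
      induction hg using Submodule.span_induction with
      | mem g hg => exact hs ⟨g, hg⟩ _ (hanti ((hσ₀ _).trans hσ) (hyf σ))
      | zero => rfl
      | add a b _ _ ha hb => exact congrArg₂ (· + ·) ha hb
      | smul c a _ ha => exact congrArg (c • ·) ha
    exact closure_minimal hspan (isClosed_eq (WeakDual.eval_continuous _)
      (WeakDual.eval_continuous _)) hf
  refine ⟨key, ?_⟩
  refine (WeakBilin.tendsto_iff_forall_eval_tendsto (topDualPairing ℝ X).flip ?_).2 fun f => ?_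
  · intro a b hab
    exact (SeparatingDual.eq_iff_forall_dual_eq (R := ℝ)).2 fun f => LinearMap.congr_fun hab f
  · obtain ⟨σ₀, hσ₀⟩ := key f
    exact tendsto_const_nhds.congr'
      ((Filter.eventually_ge_atTop σ₀).mono fun σ hσ => (hσ₀ σ hσ).symm)
end

section
/- Let X be a Banach space over ℝ whose density character (the least cardinality of a dense subset) is strictly less than ℵ_ω. Then X has the countable separation property (CSP) if and only if there is no uncountable regular cardinal κ for which there exists a family {E_σ}_{σ<κ} of closed linear subspaces of X with E_β ⊊ E_α whenever α < β < κ and ⋂_{σ<κ} E_σ = {0} (i.e., if and only if the cofinality range cr(X) contains no uncountable cardinal). -/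
open Set Cardinal Pointwise

/-- A set of functionals separates the points of `X`. -/
def SeparatesNonzero {X : Type*} [NormedAddCommGroup X] [NormedSpace ℝ X]
    (F : Set (X →L[ℝ] ℝ)) : Prop :=
  ∀ x : X, x ≠ 0 → ∃ f ∈ F, f x ≠ 0

section
variable {X : Type*} [NormedAddCommGroup X] [NormedSpace ℝ X]

/-- A point outside a closed subspace is detected by a functional vanishing on the subspace. -/
theorem Submodule.exists_continuousLinearMap_of_notMem (E : Submodule ℝ X)
    (hE : IsClosed (E : Set X)) {x : X} (hx : x ∉ E) :
    ∃ f : X →L[ℝ] ℝ, (∀ y ∈ E, f y = 0) ∧ f x ≠ 0 := by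
  have : IsClosed (E : Set X) := hE
  have hne : E.mkQL x ≠ 0 := by
    simpa using hx
  obtain ⟨g, hg⟩ := SeparatingDual.exists_ne_zero (R := ℝ) hne
  refine ⟨g.comp E.mkQL, fun y hy => ?_, hg⟩
  have : E.mkQL y = 0 := by simpa using hy
  simp [this]

theorem HasCSP.not_exists_decreasing_family (h : HasCSP X) {κ : Cardinal} (hκ : ℵ₀ < κ)
    (hreg : κ.IsRegular) :
    ¬ ∃ E : {σ : Ordinal // σ < κ.ord} → Submodule ℝ X,
      (∀ σ, IsClosed (E σ : Set X)) ∧ (∀ α β, α < β → E β < E α) ∧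
        (⋂ σ, (E σ : Set X)) = {0} := by
  rintro ⟨E, hcl, hdec, hinter⟩
  obtain ⟨F₀, hF₀, hcount, hsep⟩ := h {f | ∃ σ, ∀ y ∈ E σ, f y = 0} (by
    intro x hx
    have hx' : x ∉ ⋂ σ, (E σ : Set X) := by simpa [hinter] using hx
    obtain ⟨σ, hσ⟩ := by simpa only [mem_iInter, not_forall] using hx'
    obtain ⟨f, hf, hfx⟩ := (E σ).exists_continuousLinearMap_of_notMem (hcl σ) hσ
    exact ⟨f, ⟨σ, hf⟩, hfx⟩)
  have := hcount.to_subtype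
  choose s hs using fun f : F₀ => hF₀ f.2
  have hlt : ⨆ f, (s f : Ordinal) < κ.ord := by
    refine Ordinal.lift_iSup_lt_of_lt_cof ?_ fun f => (s f).2
    rw [lift_ord, (hreg.lift).cof_ord]
    exact (lift_le_aleph0.2 (mk_le_aleph0)).trans_lt (aleph0_lt_lift.2 hκ)
  have hlt' := (isSuccLimit_ord hreg.aleph0_le).succ_lt hlt
  have hE := hdec ⟨_, hlt⟩ ⟨_, hlt'⟩ (Order.lt_succ (⨆ f, (s f : Ordinal)))
  obtain ⟨x, hx, hx'⟩ := SetLike.exists_of_lt hE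
  obtain ⟨f, hf, hfx⟩ := hsep x (fun h0 => hx' (h0 ▸ zero_mem _))
  refine hfx (hs ⟨f, hf⟩ x ?_)
  have hanti : StrictAnti E := fun α β hαβ => hdec α β hαβ
  exact hanti.antitone (Subtype.coe_le_coe.1 (Ordinal.le_iSup (fun f => (s f : Ordinal)) ⟨f, hf⟩)) hx

/-- A separating set of functionals has a separating subset of size controlled by a dense set. -/
theorem SeparatesNonzero.exists_subset_mk_le {F : Set (X →L[ℝ] ℝ)} (hF : SeparatesNonzero F)
    {D : Set X} (hD : Dense D) :
    ∃ G ⊆ F, SeparatesNonzero G ∧ #G ≤ #(D × ℕ) := by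
  classical
  let P : D × ℕ → (X →L[ℝ] ℝ) → Prop := fun p f =>
    f ∈ F ∧ ∀ y : X, dist y p.1 < 1 / ((p.2 : ℝ) + 1) → f y ≠ 0
  have hP : ∀ p : {p // ∃ f, P p f}, ∃ f, P p f := fun p => p.2
  choose φ hφ using hP
  refine ⟨range φ, ?_, fun x hx => ?_, mk_range_le.trans (mk_subtype_le _)⟩
  · rintro _ ⟨p, rfl⟩
    exact (hφ p).1
  · obtain ⟨f, hf, hfx⟩ := hF x hx
    obtain ⟨ε, hε, hball⟩ := Metric.isOpen_iff.1
      (isOpen_ne_fun f.continuous (continuous_const (y := (0 : ℝ)))) x hfx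
    obtain ⟨n, hn⟩ := exists_nat_one_div_lt (half_pos hε)
    obtain ⟨d, hd, hxd⟩ := hD.exists_dist_lt x (Nat.one_div_pos_of_nat (α := ℝ) (n := n))
    have hp : ∃ f, P (⟨d, hd⟩, n) f := ⟨f, hf, fun y hy => hball <| by
      have := dist_triangle_right y x d
      simp only [Metric.mem_ball] at *
      linarith⟩
    exact ⟨φ ⟨_, hp⟩, mem_range_self _, (hφ ⟨_, hp⟩).2 x hxd⟩

/-- A separating set of least cardinality can be well-ordered in its initial order type so that no
member vanishes on the common kernel of its predecessors. -/
theorem SeparatesNonzero.exists_minimal_wellOrder {F : Set (X →L[ℝ] ℝ)}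
    (hF : SeparatesNonzero F) :
    ∃ (T : Set (X →L[ℝ] ℝ)) (r : T → T → Prop) (_ : IsWellOrder T r), T ⊆ F ∧
      SeparatesNonzero T ∧ (∀ G ⊆ F, SeparatesNonzero G → #T ≤ #G) ∧
      Ordinal.type r = (#T).ord ∧
      ∀ f : T, ∃ x, (f : X →L[ℝ] ℝ) x ≠ 0 ∧ ∀ g, r g f → (g : X →L[ℝ] ℝ) x = 0 := by
  let C : Set Cardinal := {c | ∃ G ⊆ F, SeparatesNonzero G ∧ #G = c}
  obtain ⟨G, hGF, hG, hGc⟩ : sInf C ∈ C := csInf_mem ⟨_, F, Subset.rfl, hF, rfl⟩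
  have hmin : ∀ H ⊆ F, SeparatesNonzero H → #G ≤ #H := fun H hHF hH =>
    hGc ▸ csInf_le' ⟨H, hHF, hH, rfl⟩
  obtain ⟨r, hr, hrt⟩ := exists_ord_eq G
  let S : Set G := {f | ∃ x, (f : X →L[ℝ] ℝ) x ≠ 0 ∧ ∀ g, r g f → (g : X →L[ℝ] ℝ) x = 0}
  let T : Set (X →L[ℝ] ℝ) := Subtype.val '' S
  have hTG : T ⊆ G := by
    rintro _ ⟨f, -, rfl⟩
    exact f.2
  have hT : SeparatesNonzero T := by
    intro x hx
    obtain ⟨f, hf, hfx⟩ := hG x hx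
    let A : Set G := {f | (f : X →L[ℝ] ℝ) x ≠ 0}
    have hA : A.Nonempty := ⟨⟨f, hf⟩, hfx⟩
    have hwf : WellFounded r := IsWellFounded.wf
    refine ⟨_, ⟨hwf.min A hA, ⟨x, hwf.min_mem A hA, fun g hg => ?_⟩, rfl⟩, hwf.min_mem A hA⟩
    by_contra hgx
    exact hwf.not_lt_min A hgx hg
  let e : T ↪ G := ⟨inclusion hTG, inclusion_injective hTG⟩
  have hcard : #T = #G := (mk_le_mk_of_subset hTG).antisymm (hmin T (hTG.trans hGF) hT)
  let re : (e ⁻¹'o r) ↪r r := RelEmbedding.preimage e r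
  have hwo : IsWellOrder T (e ⁻¹'o r) := re.isWellOrder
  refine ⟨T, e ⁻¹'o r, hwo, hTG.trans hGF, hT, hcard ▸ hmin, ?_, ?_⟩
  · refine le_antisymm ?_ (ord_le.2 (by simp))
    rw [hcard, hrt]
    exact re.ordinal_type_le
  · rintro ⟨_, f, ⟨x, hfx, hx⟩, rfl⟩
    exact ⟨x, hfx, fun g hg => hx (e g) hg⟩

/-- The common kernels of initial segments of a separating transfinite sequence, no term of which
vanishes on the common kernel of its predecessors, decrease strictly to `{0}`. -/
theorem exists_decreasing_family {κ : Cardinal} (hκ : ℵ₀ ≤ κ)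
    (f : {σ : Ordinal // σ < κ.ord} → X →L[ℝ] ℝ) (hsep : SeparatesNonzero (range f))
    (hf : ∀ σ, ∃ x, f σ x ≠ 0 ∧ ∀ τ < σ, f τ x = 0) :
    ∃ E : {σ : Ordinal // σ < κ.ord} → Submodule ℝ X,
      (∀ σ, IsClosed (E σ : Set X)) ∧ (∀ α β, α < β → E β < E α) ∧
        (⋂ σ, (E σ : Set X)) = {0} := by
  let E : {σ : Ordinal // σ < κ.ord} → Submodule ℝ X := fun σ =>
    ⨅ τ : {τ // τ < σ}, (f τ).ker
  have hmem : ∀ σ x, x ∈ E σ ↔ ∀ τ < σ, f τ x = 0 := fun σ x => by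
    simp [E, Submodule.mem_iInf]
  refine ⟨E, fun σ => ?_, fun α β hαβ => ?_, ?_⟩
  · rw [Submodule.coe_iInf]
    exact isClosed_iInter fun τ => (f τ).isClosed_ker
  · obtain ⟨x, hx, hx'⟩ := hf α
    refine SetLike.lt_iff_le_and_exists.2 ⟨fun y hy => ?_, x, (hmem _ _).2 hx', fun h => ?_⟩
    · exact (hmem _ _).2 fun τ hτ => (hmem _ _).1 hy τ (hτ.trans hαβ)
    · exact hx ((hmem _ _).1 h α hαβ)
  · refine Subset.antisymm (fun x hx => ?_) (by simp)
    by_contra h0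
    obtain ⟨_, ⟨σ, rfl⟩, hσ⟩ := hsep x h0
    have := mem_iInter.1 hx ⟨_, (isSuccLimit_ord hκ).succ_lt σ.2⟩
    exact hσ ((hmem _ _).1 this σ (Order.lt_succ (σ : Ordinal)))

end

/-- For a Banach space of density character `< ℵ_ω`, CSP holds iff there is no uncountable
regular cardinal `κ` admitting a strictly decreasing family `{E_σ}_{σ<κ}` of closed
subspaces with trivial intersection. -/
theorem hasCSP_iff_cofinalityRange (X : Type*) [NormedAddCommGroup X] [NormedSpace ℝ X]
    [CompleteSpace X]
    (hdens : ∃ D : Set X, Dense D ∧ Cardinal.mk D < Cardinal.aleph Ordinal.omega0) :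
    HasCSP X ↔ ∀ κ : Cardinal, Cardinal.aleph0 < κ → κ.IsRegular →
      ¬ ∃ E : {σ : Ordinal // σ < κ.ord} → Submodule ℝ X,
          (∀ σ, IsClosed (E σ : Set X)) ∧ (∀ α β, α < β → E β < E α) ∧
            (⋂ σ, (E σ : Set X)) = {0} := by
  refine ⟨fun h κ hκ hreg => h.not_exists_decreasing_family hκ hreg, fun h F hF => ?_⟩
  obtain ⟨T, r, hwo, hTF, hT, hmin, htype, hr⟩ :=
    SeparatesNonzero.exists_minimal_wellOrder hF
  by_contra hcsp
  have hunc : ℵ₀ < #T := by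
    by_contra hle
    exact hcsp ⟨T, hTF, le_aleph0_iff_set_countable.1 (not_lt.1 hle), hT⟩
  obtain ⟨D, hD, hDlt⟩ := hdens
  have hlt : #T < ℵ_ Ordinal.omega0 := by
    obtain ⟨G, hGF, hG, hGle⟩ := SeparatesNonzero.exists_subset_mk_le hF hD
    refine ((hmin G hGF hG).trans hGle).trans_lt ?_
    rw [mk_prod]
    refine mul_lt_of_lt (aleph0_le_aleph _) (by simpa using hDlt) ?_
    simp [aleph0_lt_aleph, Ordinal.omega0_pos]
  obtain ⟨o, ho⟩ := mem_range_aleph_iff.2 hunc.le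
  rw [← ho, aleph_lt_aleph, Ordinal.lt_omega0] at hlt
  obtain ⟨_ | n, rfl⟩ := hlt
  · simp [← ho] at hunc
  have hκ : ℵ₀ < ℵ_ ((n : Ordinal) + 1) := by simp [aleph0_lt_aleph]
  refine h (ℵ_ ((n : Ordinal) + 1)) hκ (isRegular_aleph_add_one _) ?_
  obtain ⟨i⟩ : Nonempty ((fun a b : {σ : Ordinal // σ < (ℵ_ ((n : Ordinal) + 1)).ord} => a < b)
      ≃r r) := by
    rw [← Ordinal.lift_type_eq.{_, _, 0}, htype, ← ho]
    change Ordinal.lift (Ordinal.type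
      (α := Iio (ℵ_ ((n : Ordinal) + 1)).ord) (· < ·)) = _
    rw [Ordinal.type_lt_Iio]
    simp
  refine exists_decreasing_family hκ.le (fun σ => (i σ : X →L[ℝ] ℝ)) ?_ fun σ => ?_
  · intro x hx
    obtain ⟨f, hf, hfx⟩ := hT x hx
    exact ⟨f, ⟨i.symm ⟨f, hf⟩, by simp⟩, hfx⟩
  · obtain ⟨x, hx, hx'⟩ := hr (i σ)
    exact ⟨x, hx, fun τ hτ => hx' _ (i.map_rel_iff.2 hτ)⟩
end
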